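/- arXiv:1709.04645 — 2 statements merged into one kernel-verified Lean document; each statement's English description precedes it below -/
import Mathlib

section
/- Let (G,X) be a 3-connected constraint graph that is not constraint connected, and assume that every edge of G not in X is essential. Then the subgraph G[X] has precisely two connected components, or (G,X) is the weird prism. -/
open SimpleGraph

/-- An edge set `X` is connected: any two vertices covered by `X` are joined by a path
consisting of edges of `X`.  (The empty edge set counts as connected.) -/
def EdgeSetConnected {V : Type*} (X : Set (Sym2 V)) : Prop :=
  ∀ u ∈ (fromEdgeSet X).support, ∀ v ∈ (fromEdgeSet X).support, (fromEdgeSet X).Reachable u v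

/-- The subgraph `G[X]` spanned by an edge set `X`, as a graph on the covered vertices. -/
def edgeSubgraph {V : Type*} (X : Set (Sym2 V)) :
    SimpleGraph ((fromEdgeSet X).support) :=
  (fromEdgeSet X).induce (fromEdgeSet X).support

/-- The number of connected components of `G[X]`. -/
noncomputable def edgeComponents {V : Type*} (X : Set (Sym2 V)) : ℕ :=
  Nat.card (edgeSubgraph X).ConnectedComponent

/-- A graph is `k`-connected if it has more than `k` vertices and deleting fewer than `k`
vertices always leaves a connected graph. -/
def KConnected {V : Type*} (k : ℕ) (G : SimpleGraph V) : Prop :=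
  k < Nat.card V ∧ ∀ S : Set V, S.ncard < k → (G.induce Sᶜ).Connected

/-- A constraint graph: a finite simple graph `G` together with a set `X` of edges. -/
structure CGraph : Type 1 where
  V : Type
  G : SimpleGraph V
  X : Set (Sym2 V)
  fin : Finite V := by infer_instance

attribute [instance] CGraph.fin

/-- `X` really is a set of edges of `G`. -/
def CGraph.WF (C : CGraph) : Prop := C.X ⊆ C.G.edgeSet

/-- The vertex map contracting `v` onto `u`. -/
noncomputable def contractFun {V : Type*} {u v : V} (huv : u ≠ v) (x : V) : {w : V // w ≠ v} :=
  letI := Classical.decEq V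
  if h : x = v then ⟨u, huv⟩ else ⟨x, h⟩

/-- Contraction of a simple graph, identifying `v` with `u` (loops are discarded, parallel
edges are merged, so the result is simple). -/
noncomputable def contractGraph {V : Type*} (G : SimpleGraph V) {u v : V} (huv : u ≠ v) :
    SimpleGraph {w : V // w ≠ v} :=
  fromEdgeSet (Sym2.map (contractFun huv) '' G.edgeSet)

/-- Contraction of a constraint graph: identify `v` with `u`; the new constraint consists of all
non-loop images of constraint edges; thus in each parallel class edges of `X` are preferred. -/
noncomputable def CGraph.contract (C : CGraph) (u v : C.V) (huv : u ≠ v) : CGraph where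
  V := {w : C.V // w ≠ v}
  G := contractGraph C.G huv
  X := {e | e ∈ Sym2.map (contractFun huv) '' C.X ∧ ¬ e.IsDiag}

/-- Deletion of an edge from a constraint graph. -/
def CGraph.deleteEdge (C : CGraph) (e : Sym2 C.V) : CGraph where
  V := C.V
  G := C.G.deleteEdges {e}
  X := C.X

/-- One step in forming a constraint minor: delete an edge not in `X`, or contract an edge. -/
inductive CMinorStep : CGraph → CGraph → Prop
  | del (C : CGraph) (e : Sym2 C.V) (he : e ∈ C.G.edgeSet) (hx : e ∉ C.X) :
      CMinorStep C (C.deleteEdge e)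
  | contr (C : CGraph) (u v : C.V) (h : C.G.Adj u v) :
      CMinorStep C (C.contract u v h.ne)

/-- The constraint-minor relation. -/
def IsCMinor : CGraph → CGraph → Prop := Relation.ReflTransGen CMinorStep

/-- Isomorphism of constraint graphs. -/
def CGIso (C D : CGraph) : Prop :=
  ∃ φ : C.G ≃g D.G, Sym2.map (⇑φ) '' C.X = D.X

/-- The constraint `K₄`. -/
def constraintK4 : CGraph where
  V := Fin 4
  G := ⊤
  X := {s(0, 1), s(2, 3)}

def wheelGraph : SimpleGraph (Fin 5) :=
  fromEdgeSet {s(0, 1), s(1, 2), s(2, 3), s(3, 0), s(0, 4), s(1, 4), s(2, 4), s(3, 4)}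

/-- The constraint wheel. -/
def constraintWheel : CGraph where
  V := Fin 5
  G := wheelGraph
  X := {s(0, 1), s(2, 3)}

/-- The prism `K₃ □ K₂`, with triangles `{0,1,2}` and `{3,4,5}`. -/
def prismGraph : SimpleGraph (Fin 6) :=
  fromEdgeSet {s(0, 1), s(1, 2), s(0, 2), s(3, 4), s(4, 5), s(3, 5), s(0, 3), s(1, 4), s(2, 5)}

def topEdges : Set (Sym2 (Fin 6)) := {s(0, 1), s(1, 2), s(0, 2)}
def botEdges : Set (Sym2 (Fin 6)) := {s(3, 4), s(4, 5), s(3, 5)}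

/-- Constraint sets of the four constraint prisms: contained in the two triangles and meeting
every vertex, inducing a spanning connected subgraph of each triangle. -/
def PrismConstraintSet (X : Set (Sym2 (Fin 6))) : Prop :=
  X ⊆ topEdges ∪ botEdges ∧
  EdgeSetConnected (X ∩ topEdges) ∧ (fromEdgeSet (X ∩ topEdges)).support = {0, 1, 2} ∧
  EdgeSetConnected (X ∩ botEdges) ∧ (fromEdgeSet (X ∩ botEdges)).support = {3, 4, 5}

/-- `C` is one of the four constraint prisms. -/
def IsConstraintPrism (C : CGraph) : Prop :=
  ∃ X, PrismConstraintSet X ∧ CGIso C (CGraph.mk (Fin 6) prismGraph X)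

/-- The six obstructions. -/
def IsObstruction (D : CGraph) : Prop :=
  CGIso D constraintK4 ∨ CGIso D constraintWheel ∨ IsConstraintPrism D

/-- The weird prism. -/
def weirdPrism : CGraph where
  V := Fin 6
  G := prismGraph
  X := {s(0, 3), s(1, 4), s(2, 5)}

/-- The Wagner graph `V₈`. -/
def wagnerGraph : SimpleGraph (Fin 8) :=
  fromEdgeSet {s(0, 1), s(1, 2), s(2, 3), s(3, 4), s(4, 5), s(5, 6), s(6, 7), s(7, 0),
    s(0, 4), s(1, 5), s(2, 6), s(3, 7)}

/-- The constraint Wagner graph: `X` is the complement of the 6-cycle `0-1-5-4-3-7-0`. -/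
def constraintWagner : CGraph where
  V := Fin 8
  G := wagnerGraph
  X := {s(1, 2), s(2, 3), s(5, 6), s(6, 7), s(0, 4), s(2, 6)}

/-- The Wagner prism. -/
def wagnerPrism : CGraph where
  V := Fin 6
  G := prismGraph
  X := {s(0, 3), s(1, 2), s(4, 5)}

/-- `(G, X)` has a 3-connected constraint minor whose constraint is disconnected. -/
def BadMinor (C : CGraph) : Prop :=
  ∃ C', IsCMinor C C' ∧ KConnected 3 C'.G ∧ ¬ EdgeSetConnected C'.X

/-- An edge `e ∉ X` is essential if neither `(G/e, X ∩ E(G/e))` nor `(G∖e, X)` has a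
3-connected constraint minor with disconnected constraint. -/
def Essential (C : CGraph) (e : Sym2 C.V) : Prop :=
  ¬ BadMinor (C.deleteEdge e) ∧
  ∀ u v, ∀ h : C.G.Adj u v, s(u, v) = e → ¬ BadMinor (C.contract u v h.ne)

/-- An edge joining two distinct components of `G[X]`. -/
def JoinsComponents {V : Type*} (X : Set (Sym2 V)) (e : Sym2 V) : Prop :=
  ∃ a b, e = s(a, b) ∧ a ∈ (fromEdgeSet X).support ∧ b ∈ (fromEdgeSet X).support ∧
    ¬ (fromEdgeSet X).Reachable a b

/-- The degree of a vertex. -/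
noncomputable def vdeg {V : Type*} (G : SimpleGraph V) (v : V) : ℕ := (G.neighborSet v).ncard

/-- The component of `G[X]` containing the edge `f` consists of the single edge `f`. -/
def SingleEdgeComponent {V : Type*} (X : Set (Sym2 V)) (f : Sym2 V) : Prop :=
  f ∈ X ∧ ∀ g ∈ X, (∃ a ∈ f, ∃ b ∈ g, (fromEdgeSet X).Reachable a b) → g = f

/-- The edges of `Q` with all endvertices in `S`: the edges of the side `Q[S]`. -/
def sideEdges {V : Type*} (Q : SimpleGraph V) (S : Set V) : Set (Sym2 V) :=
  {e | e ∈ Q.edgeSet ∧ ∀ v ∈ e, v ∈ S}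

/-- The edges of `Q` with one endvertex in `S` and one outside `S`. -/
def crossEdges {V : Type*} (Q : SimpleGraph V) (S : Set V) : Set (Sym2 V) :=
  {e | e ∈ Q.edgeSet ∧ (∃ v ∈ e, v ∈ S) ∧ ∃ v ∈ e, v ∉ S}

/-- `d` is a bond of `Q` with sides induced by `S` and `Sᶜ`. -/
def IsBondWith {V : Type*} (Q : SimpleGraph V) (d : Set (Sym2 V)) (S : Set V) : Prop :=
  S.Nonempty ∧ Sᶜ.Nonempty ∧ (Q.induce S).Connected ∧ (Q.induce Sᶜ).Connected ∧
    d = crossEdges Q S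

/-- `Q` is 3-connected along the bond `d` (with left side `S`): `Q` is 2-connected and no pair
of vertices, one from each side, separates `Q`. -/
def ThreeConnAlong {V : Type*} (Q : SimpleGraph V) (d : Set (Sym2 V)) (S : Set V) : Prop :=
  IsBondWith Q d S ∧ KConnected 2 Q ∧
    ∀ x ∈ S, ∀ y ∈ Sᶜ, (Q.induce ({x, y}ᶜ : Set V)).Preconnected

/-- One step of a special contraction minor: contract an edge not in the bond. -/
inductive SCMStep : CGraph → CGraph → Prop
  | contr (C : CGraph) (u v : C.V) (h : C.G.Adj u v) (hd : s(u, v) ∉ C.X) :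
      SCMStep C (C.contract u v h.ne)

/-- The special-contraction-minor relation. -/
def IsSCMinor : CGraph → CGraph → Prop := Relation.ReflTransGen SCMStep

/-- A proper (non-identical) special contraction minor. -/
def IsProperSCMinor : CGraph → CGraph → Prop := Relation.TransGen SCMStep

/-- The special `K₄`: `K₄` together with a bond of size 4. -/
def specialK4 : CGraph where
  V := Fin 4
  G := ⊤
  X := {s(0, 2), s(0, 3), s(1, 2), s(1, 3)}

/-- The special prism: the prism together with the bond complementing the two triangles. -/
def specialPrism : CGraph where
  V := Fin 6
  G := prismGraph
  X := {s(0, 3), s(1, 4), s(2, 5)}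

/-- `(Q, d)` is 3-connected along `d` and both sides of `d` contain edges. -/
def GoodAlong (C : CGraph) : Prop :=
  ∃ S : Set C.V, ThreeConnAlong C.G C.X S ∧
    (sideEdges C.G S).Nonempty ∧ (sideEdges C.G Sᶜ).Nonempty

/-- `(Q, d)` is irreducible. -/
def BondIrreducible (C : CGraph) : Prop :=
  (∃ S : Set C.V, ThreeConnAlong C.G C.X S) ∧
  ¬ ∃ C', IsProperSCMinor C C' ∧ GoodAlong C'

/-- An edge set forming a triangle. -/
def IsTriangle {V : Type*} (X : Set (Sym2 V)) : Prop :=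
  ∃ a b c : V, a ≠ b ∧ a ≠ c ∧ b ≠ c ∧ X = {s(a, b), s(b, c), s(a, c)}

/-- An edge set consisting of a single edge. -/
def IsSingleEdge {V : Type*} (X : Set (Sym2 V)) : Prop :=
  ∃ a b : V, a ≠ b ∧ X = {s(a, b)}

/-- `M` is (isomorphic to) the cycle matroid of `G`, via the bijection `f` between the ground
set of `M` and the edges of `G`: a set is independent iff its image is a forest. -/
def IsGraphicRep {α : Type} (M : Matroid α) {V : Type} (G : SimpleGraph V)
    (f : α → Sym2 V) : Prop :=
  Set.BijOn f M.E G.edgeSet ∧ ∀ I ⊆ M.E, (M.Indep I ↔ (fromEdgeSet (f '' I)).IsAcyclic)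

/-- The constraint matroid `(M, X)` is realisable. -/
def Realisable {α : Type} (M : Matroid α) (X : Set α) : Prop :=
  ∃ (V : Type) (_ : Finite V) (G : SimpleGraph V) (f : α → Sym2 V),
    IsGraphicRep M G f ∧ EdgeSetConnected (f '' X)

/-- Deletion of a set of elements from a matroid. -/
def Matroid.del {α : Type} (M : Matroid α) (D : Set α) : Matroid α := Matroid.restrict M (M.E \ D)

/-- Contraction of a set of elements of a matroid. -/
def Matroid.con {α : Type} (M : Matroid α) (C : Set α) : Matroid α :=
  Matroid.dual (Matroid.del (Matroid.dual M) C)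

/-- `(N, Y)` is a constraint minor of `(M, X)`: contract an arbitrary set `C` and delete a
set `D` of elements not in `X`. -/
def MatroidCMinor {α : Type} (M : Matroid α) (X : Set α) (N : Matroid α) (Y : Set α) : Prop :=
  ∃ C D : Set α, D ⊆ M.E \ X ∧ N = (M.con C).del D ∧ Y = X \ C

/-- `(N, Y)` is isomorphic, via the cycle matroid, to one of the six obstructions. -/
def MatroidObstruction {α : Type} (N : Matroid α) (Y : Set α) : Prop :=
  (∃ f : α → Sym2 (Fin 4), IsGraphicRep N constraintK4.G f ∧ f '' Y = constraintK4.X) ∨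
  (∃ f : α → Sym2 (Fin 5), IsGraphicRep N constraintWheel.G f ∧ f '' Y = constraintWheel.X) ∨
  (∃ X, PrismConstraintSet X ∧
    ∃ f : α → Sym2 (Fin 6), IsGraphicRep N prismGraph f ∧ f '' Y = X)


namespace TCW

variable {V : Type*}

/-- A separation of order at most two. -/
def Sep (G : SimpleGraph V) (P Q : Set V) : Prop :=
  P.Nonempty ∧ Q.Nonempty ∧ Disjoint P Q ∧ (∀ x ∈ P, ∀ y ∈ Q, ¬ G.Adj x y) ∧
    (P ∪ Q)ᶜ.ncard ≤ 2

lemma Sep.symm {G : SimpleGraph V} {P Q : Set V} (h : Sep G P Q) : Sep G Q P := by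
  obtain ⟨h1, h2, h3, h4, h5⟩ := h
  exact ⟨h2, h1, h3.symm, fun x hx y hy hxy => h4 y hy x hx hxy.symm, by rwa [Set.union_comm]⟩

lemma reach_closed {G : SimpleGraph V} (P : V → Prop)
    (hP : ∀ x y, G.Adj x y → P x → P y) {x y : V} (h : G.Reachable x y) (hx : P x) : P y := by
  obtain ⟨w⟩ := h
  induction w with
  | nil => exact hx
  | cons hadj _ ih => exact ih (hP _ _ hadj hx)

lemma kconn_iff [Finite V] (G : SimpleGraph V) :
    KConnected 3 G ↔ 3 < Nat.card V ∧ ∀ P Q, ¬ Sep G P Q := by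
  constructor
  · rintro ⟨h1, h2⟩
    refine ⟨h1, ?_⟩
    rintro P Q ⟨⟨p, hp⟩, ⟨q, hq⟩, hd, hn, hc⟩
    have hcon := h2 (P ∪ Q)ᶜ (by omega)
    have hr := hcon.preconnected ⟨p, by simp [hp]⟩ ⟨q, by simp [hq]⟩
    have := reach_closed (fun z => z.1 ∈ P) (by
      rintro ⟨x, hx⟩ ⟨y, hy⟩ hxy hxP
      simp only [comap_adj, Function.Embedding.subtype_apply] at hxy
      rw [compl_compl] at hy
      rcases hy with hy | hy
      · exact hy
      · exact absurd hxy (hn x hxP y hy)) hr hp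
    exact Set.disjoint_left.1 hd this hq
  · rintro ⟨h1, h2⟩
    refine ⟨h1, ?_⟩
    intro S hS
    have hne : (Sᶜ).Nonempty := by
      by_contra hcon
      rw [Set.not_nonempty_iff_eq_empty, Set.compl_empty_iff] at hcon
      subst hcon
      rw [Set.ncard_univ] at hS
      omega
    haveI : Nonempty (↑Sᶜ : Type _) := hne.to_subtype
    refine ⟨?_⟩
    intro x y
    by_contra hxy
    refine h2 (Subtype.val '' {z | (G.induce Sᶜ).Reachable x z})
      (Subtype.val '' {z | ¬ (G.induce Sᶜ).Reachable x z}) ⟨⟨x, x, Reachable.refl _, rfl⟩,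
      ⟨y, y, hxy, rfl⟩, ?_, ?_, ?_⟩
    · rw [Set.disjoint_left]
      rintro _ ⟨z, hz, rfl⟩ ⟨z', hz', he⟩
      rw [Subtype.ext he] at hz'
      exact hz' hz
    · rintro _ ⟨z, hz, rfl⟩ _ ⟨z', hz', rfl⟩ hadj
      apply hz'
      exact Reachable.trans hz (Adj.reachable (G := G.induce Sᶜ) hadj)
    · have : (Subtype.val '' {z | (G.induce Sᶜ).Reachable x z} ∪
        Subtype.val '' {z | ¬ (G.induce Sᶜ).Reachable x z})ᶜ ⊆ S := by
        intro z hz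
        by_contra hzS
        apply hz
        by_cases hr : (G.induce Sᶜ).Reachable x ⟨z, hzS⟩
        · exact Or.inl ⟨_, hr, rfl⟩
        · exact Or.inr ⟨_, hr, rfl⟩
      have := Set.ncard_le_ncard this (Set.toFinite S)
      omega

lemma cf_self {u v : V} (h : u ≠ v) : contractFun h v = ⟨u, h⟩ := by
  simp [contractFun]

lemma cf_ne {u v : V} (h : u ≠ v) {x : V} (hx : x ≠ v) : contractFun h x = ⟨x, hx⟩ := by
  simp [contractFun, hx]

lemma cf_eq {u v : V} (h : u ≠ v) {x y : V} (hxy : contractFun h x = contractFun h y) :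
    x = y ∨ (x = u ∧ y = v) ∨ (x = v ∧ y = u) := by
  by_cases hx : x = v <;> by_cases hy : y = v
  · left; rw [hx, hy]
  · subst hx
    rw [cf_self, cf_ne h hy] at hxy
    have := congrArg Subtype.val hxy
    simp at this
    right; right; exact ⟨rfl, this.symm⟩
  · subst hy
    rw [cf_self, cf_ne h hx] at hxy
    have := congrArg Subtype.val hxy
    simp at this
    right; left; exact ⟨this, rfl⟩
  · rw [cf_ne h hx, cf_ne h hy] at hxy
    left; exact congrArg Subtype.val hxy

lemma mem_map_image {W : Type*} (f : V → W) (E : Set (Sym2 V)) (x y : W) :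
    s(x, y) ∈ Sym2.map f '' E ↔ ∃ s t, s(s, t) ∈ E ∧ f s = x ∧ f t = y := by
  constructor
  · rintro ⟨e, he, hm⟩
    induction e using Sym2.ind with
    | _ s t =>
      rw [Sym2.map_mk] at hm
      rcases Sym2.eq_iff.1 hm with ⟨h1, h2⟩ | ⟨h1, h2⟩
      · exact ⟨s, t, he, h1, h2⟩
      · exact ⟨t, s, by rwa [Sym2.eq_swap], h2, h1⟩
  · rintro ⟨s, t, he, rfl, rfl⟩
    exact ⟨_, he, rfl⟩

lemma contract_adj (G : SimpleGraph V) {u v : V} (h : u ≠ v) (x y : {w : V // w ≠ v}) :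
    (contractGraph G h).Adj x y ↔
      x ≠ y ∧ ∃ s t, G.Adj s t ∧ contractFun h s = x ∧ contractFun h t = y := by
  unfold contractGraph
  rw [fromEdgeSet_adj, mem_map_image]
  simp only [mem_edgeSet]
  tauto

lemma contract_adj_of (G : SimpleGraph V) {u v : V} (h : u ≠ v) {x y : V} (hx : x ≠ v)
    (hy : y ≠ v) (hxy : G.Adj x y) : (contractGraph G h).Adj ⟨x, hx⟩ ⟨y, hy⟩ :=
  (contract_adj G h _ _).2 ⟨fun he => hxy.ne (congrArg Subtype.val he),
    x, y, hxy, cf_ne h hx, cf_ne h hy⟩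

lemma compl_lift {v : V} (P Q : Set {w : V // w ≠ v}) :
    (Subtype.val '' P ∪ Subtype.val '' Q)ᶜ = insert v (Subtype.val '' (P ∪ Q)ᶜ) := by
  ext z
  by_cases hz : z = v
  · subst hz; simp
  · simp [hz]

/-- Lifting separations along contraction at a vertex of degree two. -/
lemma sep_lift [Finite V] (H : SimpleGraph V) {a u b : V} (hau : a ≠ u) (hbu : b ≠ u)
    (hb : H.Adj u b)
    (hN : ∀ x, H.Adj u x → x = a ∨ x = b) {P' Q' : Set {w : V // w ≠ u}}
    (hs : Sep (contractGraph H hau) P' Q') :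
    ∃ P Q, Sep H P Q ∧ Subtype.val '' P' ⊆ P ∧ Subtype.val '' Q' ⊆ Q := by
  obtain ⟨h1, h2, h3, h4, h5⟩ := hs
  have hnadj : ∀ x ∈ Subtype.val '' P', ∀ y ∈ Subtype.val '' Q', ¬ H.Adj x y := by
    rintro _ ⟨x, hx, rfl⟩ _ ⟨y, hy, rfl⟩ hxy
    exact h4 x hx y hy (contract_adj_of H hau x.2 y.2 hxy)
  have hdis : Disjoint (Subtype.val '' P') (Subtype.val '' Q') :=
    (Set.disjoint_image_iff Subtype.val_injective).2 h3
  have huP : u ∉ Subtype.val '' P' := by rintro ⟨x, _, hx⟩; exact x.2 hx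
  have huQ : u ∉ Subtype.val '' Q' := by rintro ⟨x, _, hx⟩; exact x.2 hx
  have hab : a ≠ b → (contractGraph H hau).Adj ⟨a, hau⟩ ⟨b, hbu⟩ := fun hne =>
    (contract_adj H hau _ _).2 ⟨fun he => hne (congrArg Subtype.val he), u, b, hb, cf_self _,
      cf_ne _ hbu⟩
  have hcard : ∀ S : Set V, S ⊆ Subtype.val '' (P' ∪ Q')ᶜ → S.ncard ≤ 2 := by
    intro S hS
    have := Set.ncard_le_ncard hS (Set.toFinite _)
    have := Set.ncard_image_le (f := Subtype.val) (Set.toFinite (P' ∪ Q')ᶜ)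
    omega
  by_cases hc : a ∈ Subtype.val '' Q' ∨ b ∈ Subtype.val '' Q'
  · refine ⟨Subtype.val '' P', insert u (Subtype.val '' Q'), ⟨h1.image _, ⟨u, by simp⟩, ?_, ?_, ?_⟩,
      subset_rfl, Set.subset_insert _ _⟩
    · rw [Set.disjoint_insert_right]; exact ⟨huP, hdis⟩
    · intro x hx y hy hxy
      rcases hy with rfl | hy
      · rcases hN x hxy.symm with rfl | rfl
        · rcases hc with hc | hc
          · exact Set.disjoint_left.1 hdis hx hc
          · have hne : x ≠ b := fun he => Set.disjoint_left.1 hdis hx (he ▸ hc)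
            obtain ⟨x', hx', rfl⟩ := hx
            obtain ⟨b', hb', rfl⟩ := hc
            exact h4 _ hx' _ hb' (hab hne)
        · rcases hc with hc | hc
          · have hne : x ≠ a := fun he => Set.disjoint_left.1 hdis hx (he ▸ hc)
            obtain ⟨x', hx', rfl⟩ := hx
            obtain ⟨b', hb', rfl⟩ := hc
            exact h4 _ hx' _ hb' (hab hne.symm).symm
          · exact Set.disjoint_left.1 hdis hx hc
      · exact hnadj x hx y hy hxy
    · apply hcard
      intro z hz
      have hz' : z ∈ (Subtype.val '' P' ∪ Subtype.val '' Q')ᶜ := by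
        intro hh; apply hz; rcases hh with hh | hh
        · exact Or.inl hh
        · exact Or.inr (Or.inr hh)
      rw [compl_lift] at hz'
      rcases hz' with rfl | hz'
      · exact absurd (Or.inr (Or.inl rfl)) hz
      · exact hz'
  · refine ⟨insert u (Subtype.val '' P'), Subtype.val '' Q', ⟨⟨u, by simp⟩, h2.image _, ?_, ?_, ?_⟩,
      Set.subset_insert _ _, subset_rfl⟩
    · rw [Set.disjoint_insert_left]; exact ⟨huQ, hdis⟩
    · intro x hx y hy hxy
      rcases hx with rfl | hx
      · rcases hN y hxy with rfl | rfl
        · exact hc (Or.inl hy)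
        · exact hc (Or.inr hy)
      · exact hnadj x hx y hy hxy
    · apply hcard
      intro z hz
      have hz' : z ∈ (Subtype.val '' P' ∪ Subtype.val '' Q')ᶜ := by
        intro hh; apply hz; rcases hh with hh | hh
        · exact Or.inl (Or.inr hh)
        · exact Or.inr hh
      rw [compl_lift] at hz'
      rcases hz' with rfl | hz'
      · exact absurd (Or.inl (Or.inl rfl)) hz
      · exact hz'

/-- A separation of the contraction yields a 3-separation through the contracted edge. -/
lemma sep_noncontr [Finite V] (G : SimpleGraph V) (hG : ∀ P Q, ¬ Sep G P Q) {u v : V}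
    (huv : u ≠ v) {P' Q' : Set {w : V // w ≠ v}}
    (hs : Sep (contractGraph G huv) P' Q') :
    ∃ A B : Set V, A.Nonempty ∧ B.Nonempty ∧ Disjoint A B ∧ (∀ x ∈ A, ∀ y ∈ B, ¬ G.Adj x y) ∧
      (A ∪ B)ᶜ.ncard ≤ 3 ∧ u ∉ A ∧ u ∉ B ∧ v ∉ A ∧ v ∉ B := by
  have key : ∀ P' Q' : Set {w : V // w ≠ v}, Sep (contractGraph G huv) P' Q' →
      u ∉ Subtype.val '' P' := by
    rintro P' Q' ⟨h1, h2, h3, h4, h5⟩ hu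
    obtain ⟨⟨u', hu'⟩, huP, rfl⟩ := hu
    have hdis : Disjoint (Subtype.val '' P') (Subtype.val '' Q') :=
      (Set.disjoint_image_iff Subtype.val_injective).2 h3
    refine hG (insert v (Subtype.val '' P')) (Subtype.val '' Q') ⟨⟨v, by simp⟩, h2.image _, ?_, ?_, ?_⟩
    · rw [Set.disjoint_insert_left]; refine ⟨?_, hdis⟩
      rintro ⟨x, _, hx⟩; exact x.2 hx
    · intro x hx y hy hxy
      obtain ⟨y, hy, rfl⟩ := hy
      rcases hx with rfl | ⟨x, hx, rfl⟩
      · have hne : (⟨u', huv⟩ : {w : V // w ≠ x}) ≠ y := fun he =>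
          Set.disjoint_left.1 h3 huP (he ▸ hy)
        exact h4 _ huP _ hy ((contract_adj G huv _ _).2 ⟨hne, x, y, hxy, cf_self _, cf_ne _ y.2⟩)
      · exact h4 x hx y hy (contract_adj_of G huv x.2 y.2 hxy)
    · have hsub : (insert v (Subtype.val '' P') ∪ Subtype.val '' Q')ᶜ ⊆
          Subtype.val '' (P' ∪ Q')ᶜ := by
        intro z hz
        have hz' : z ∈ (Subtype.val '' P' ∪ Subtype.val '' Q')ᶜ := by
          intro hh; apply hz; rcases hh with hh | hh
          · exact Or.inl (Or.inr hh)
          · exact Or.inr hh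
        rw [compl_lift] at hz'
        rcases hz' with rfl | hz'
        · exact absurd (Or.inl (Or.inl rfl)) hz
        · exact hz'
      have := Set.ncard_le_ncard hsub (Set.toFinite _)
      have := Set.ncard_image_le (f := Subtype.val) (Set.toFinite (P' ∪ Q')ᶜ)
      omega
  have k1 := key _ _ hs
  have k2 := key _ _ hs.symm
  obtain ⟨h1, h2, h3, h4, h5⟩ := hs
  refine ⟨Subtype.val '' P', Subtype.val '' Q', h1.image _, h2.image _,
    (Set.disjoint_image_iff Subtype.val_injective).2 h3, ?_, ?_, k1, k2, ?_, ?_⟩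
  · rintro _ ⟨x, hx, rfl⟩ _ ⟨y, hy, rfl⟩ hxy
    exact h4 x hx y hy (contract_adj_of G huv x.2 y.2 hxy)
  · rw [compl_lift]
    have := Set.ncard_insert_le v (Subtype.val '' (P' ∪ Q')ᶜ)
    have := Set.ncard_image_le (f := Subtype.val) (Set.toFinite (P' ∪ Q')ᶜ)
    omega
  · rintro ⟨x, _, hx⟩; exact x.2 hx
  · rintro ⟨x, _, hx⟩; exact x.2 hx

lemma crossing_aux [Finite V] (G : SimpleGraph V) (hG : ∀ P Q, ¬ Sep G P Q) {u v : V}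
    {A B U W : Set V} (hB : B.Nonempty) (hAB : Disjoint A B)
    (hnAB : ∀ x ∈ A, ∀ y ∈ B, ¬ G.Adj x y) (hT : (A ∪ B)ᶜ.ncard ≤ 3)
    (huA : u ∉ A) (huB : u ∉ B) (hvA : v ∉ A) (hvB : v ∉ B)
    (huU : u ∈ U) (hvW : v ∈ W) (hUW : Disjoint U W)
    (hn : ∀ x ∈ U, ∀ y ∈ W, G.Adj x y → x = u ∧ y = v) (hS : (U ∪ W)ᶜ.ncard ≤ 2)
    (hWB : W ∩ B = ∅) (hSB : (U ∪ W)ᶜ ∩ B = ∅) : False := by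
  have huW : u ∉ W := fun h => Set.disjoint_left.1 hUW huU h
  have huv : u ≠ v := fun h => huW (h ▸ hvW)
  have hBU : ∀ x ∈ B, x ∈ U := by
    intro x hx
    by_contra hxU
    by_cases hxW : x ∈ W
    · exact (Set.eq_empty_iff_forall_notMem.1 hWB x) ⟨hxW, hx⟩
    · exact (Set.eq_empty_iff_forall_notMem.1 hSB x) ⟨fun h => h.elim hxU hxW, hx⟩
  refine hG (insert v A) B ⟨⟨v, by simp⟩, hB, ?_, ?_, ?_⟩
  · rw [Set.disjoint_insert_left]; exact ⟨hvB, hAB⟩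
  · intro x hx y hy hxy
    rcases hx with rfl | hx
    · exact huB ((hn y (hBU y hy) x hvW hxy.symm).1 ▸ hy)
    · exact hnAB x hx y hy hxy
  · have hv : v ∈ (A ∪ B)ᶜ := fun h => h.elim hvA hvB
    have : (insert v A ∪ B)ᶜ = (A ∪ B)ᶜ \ {v} := by
      ext z; simp; tauto
    rw [this]
    have := Set.ncard_sdiff_singleton_add_one hv (Set.toFinite _)
    omega

lemma crossing_aux2 [Finite V] (G : SimpleGraph V) (hG : ∀ P Q, ¬ Sep G P Q) {u v : V}
    {A B U W : Set V} (hAB : Disjoint A B)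
    (hnAB : ∀ x ∈ A, ∀ y ∈ B, ¬ G.Adj x y)
    (huA : u ∉ A) (huB : u ∉ B)
    (huU : u ∈ U) (hvW : v ∈ W) (hUW : Disjoint U W)
    (hn : ∀ x ∈ U, ∀ y ∈ W, G.Adj x y → x = u ∧ y = v) (hS : (U ∪ W)ᶜ.ncard ≤ 2)
    (hTW : ∀ x ∈ W, x ≠ v → x ∈ A ∪ B)
    (hne : ∃ x ∈ W, x ≠ v ∧ x ∈ A) : (U ∪ W)ᶜ ∩ B = ∅ ∧ (U ∪ W)ᶜ.ncard = 2 := by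
  have huW : u ∉ W := fun h => Set.disjoint_left.1 hUW huU h
  have huv : u ≠ v := fun h => huW (h ▸ hvW)
  by_contra hcon
  have hcard : ((U ∪ W)ᶜ \ B).ncard ≤ 1 := by
    by_cases h : (U ∪ W)ᶜ ∩ B = ∅
    · have : (U ∪ W)ᶜ.ncard ≠ 2 := fun h' => hcon ⟨h, h'⟩
      have := Set.ncard_le_ncard (Set.sdiff_subset (s := (U ∪ W)ᶜ) (t := B)) (Set.toFinite _)
      omega
    · obtain ⟨z, hz⟩ := Set.nonempty_iff_ne_empty.2 h
      have := Set.ncard_lt_ncard (s := (U ∪ W)ᶜ \ B) (t := (U ∪ W)ᶜ)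
        ⟨Set.sdiff_subset, fun hh => (hh hz.1).2 hz.2⟩ (Set.toFinite _)
      omega
  obtain ⟨x0, hx0, hx0v, hx0A⟩ := hne
  have huS : u ∉ (U ∪ W)ᶜ := fun h => h (Or.inl huU)
  refine hG ((W \ {v}) ∩ A) (((W \ {v}) ∩ A) ∪ insert v ((U ∪ W)ᶜ \ B))ᶜ
    ⟨⟨x0, ⟨hx0, hx0v⟩, hx0A⟩, ⟨u, ?_⟩, ?_, ?_, ?_⟩
  · rintro (h | h | h)
    · exact huW h.1.1
    · exact huv h
    · exact huS h.1
  · rw [Set.disjoint_left]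
    intro z hz hz'
    exact hz' (Or.inl hz)
  · rintro x ⟨⟨hxW, hxv⟩, hxA⟩ y hy hxy
    have hyB : y ∉ B := fun h => hnAB x hxA y h hxy
    have hyU : y ∉ U := fun h => hxv (hn y h x hxW hxy.symm).2
    have hyv : y ≠ v := fun h => hy (Or.inr (Or.inl h))
    by_cases hyW : y ∈ W
    · rcases hTW y hyW hyv with h | h
      · exact hy (Or.inl ⟨⟨hyW, hyv⟩, h⟩)
      · exact hyB h
    · exact hy (Or.inr (Or.inr ⟨fun h => h.elim hyU hyW, hyB⟩))
  · have hsub : (((W \ {v}) ∩ A) ∪ (((W \ {v}) ∩ A) ∪ insert v ((U ∪ W)ᶜ \ B))ᶜ)ᶜ ⊆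
        insert v ((U ∪ W)ᶜ \ B) := by
      intro z hz
      by_contra hh
      apply hz
      by_cases h : z ∈ (W \ {v}) ∩ A
      · exact Or.inl h
      · exact Or.inr (fun h' => h'.elim h hh)
    have := Set.ncard_le_ncard hsub (Set.toFinite _)
    have := Set.ncard_insert_le v ((U ∪ W)ᶜ \ B)
    omega

lemma crossing_half [Finite V] (G : SimpleGraph V) (hG : ∀ P Q, ¬ Sep G P Q) {u v : V}
    {A B U W : Set V} (hA : A.Nonempty) (hB : B.Nonempty) (hAB : Disjoint A B)
    (hnAB : ∀ x ∈ A, ∀ y ∈ B, ¬ G.Adj x y) (hT : (A ∪ B)ᶜ.ncard ≤ 3)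
    (huA : u ∉ A) (huB : u ∉ B) (hvA : v ∉ A) (hvB : v ∉ B)
    (huU : u ∈ U) (hvW : v ∈ W) (hUW : Disjoint U W)
    (hn : ∀ x ∈ U, ∀ y ∈ W, G.Adj x y → x = u ∧ y = v) (hS : (U ∪ W)ᶜ.ncard ≤ 2)
    (hTW : ∀ x ∈ W, x ≠ v → x ∈ A ∪ B)
    (hW : ∃ x ∈ W, x ≠ v) : False := by
  have huW : u ∉ W := fun h => Set.disjoint_left.1 hUW huU h
  have huv : u ≠ v := fun h => huW (h ▸ hvW)
  have hnBA : ∀ x ∈ B, ∀ y ∈ A, ¬ G.Adj x y := fun x hx y hy h => hnAB y hy x hx h.symm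
  have hTW' : ∀ x ∈ W, x ≠ v → x ∈ B ∪ A := by rw [Set.union_comm]; exact hTW
  have hT' : (B ∪ A)ᶜ.ncard ≤ 3 := by rwa [Set.union_comm]
  by_cases ha : ∃ x ∈ W, x ≠ v ∧ x ∈ A <;> by_cases hb : ∃ x ∈ W, x ≠ v ∧ x ∈ B
  · obtain ⟨e1, e2⟩ := crossing_aux2 G hG hAB hnAB huA huB huU hvW hUW hn hS hTW ha
    obtain ⟨e3, _⟩ := crossing_aux2 G hG hAB.symm hnBA huB huA huU hvW hUW hn hS hTW' hb
    have hsub : insert u (insert v (U ∪ W)ᶜ) ⊆ (A ∪ B)ᶜ := by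
      rintro z (rfl | rfl | hz)
      · exact fun h => h.elim huA huB
      · exact fun h => h.elim hvA hvB
      · rintro (h | h)
        · exact Set.eq_empty_iff_forall_notMem.1 e3 z ⟨hz, h⟩
        · exact Set.eq_empty_iff_forall_notMem.1 e1 z ⟨hz, h⟩
    have h1 := Set.ncard_le_ncard hsub (Set.toFinite _)
    rw [Set.ncard_insert_of_notMem (by
      rintro (h | h)
      · exact huv h
      · exact h (Or.inl huU)), Set.ncard_insert_of_notMem (s := (U ∪ W)ᶜ) (fun h => h (Or.inr hvW))] at h1
    omega
  · obtain ⟨e1, e2⟩ := crossing_aux2 G hG hAB hnAB huA huB huU hvW hUW hn hS hTW ha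
    refine crossing_aux G hG hB hAB hnAB hT huA huB hvA hvB huU hvW hUW hn hS ?_ e1
    rw [Set.eq_empty_iff_forall_notMem]
    rintro x ⟨hx, hxB⟩
    exact hb ⟨x, hx, fun h => hvB (h ▸ hxB), hxB⟩
  · obtain ⟨e1, e2⟩ := crossing_aux2 G hG hAB.symm hnBA huB huA huU hvW hUW hn hS hTW' hb
    refine crossing_aux G hG hA hAB.symm hnBA hT' huB huA hvB hvA huU hvW hUW hn hS ?_ e1
    rw [Set.eq_empty_iff_forall_notMem]
    rintro x ⟨hx, hxB⟩
    exact ha ⟨x, hx, fun h => hvA (h ▸ hxB), hxB⟩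
  · obtain ⟨x, hx, hxv⟩ := hW
    rcases hTW x hx hxv with h | h
    · exact ha ⟨x, hx, hxv, h⟩
    · exact hb ⟨x, hx, hxv, h⟩

lemma crossing [Finite V] (G : SimpleGraph V) (hG : ∀ P Q, ¬ Sep G P Q) {u v : V}
    {A B U W : Set V} (hA : A.Nonempty) (hB : B.Nonempty) (hAB : Disjoint A B)
    (hnAB : ∀ x ∈ A, ∀ y ∈ B, ¬ G.Adj x y) (hT : (A ∪ B)ᶜ.ncard ≤ 3)
    (huA : u ∉ A) (huB : u ∉ B) (hvA : v ∉ A) (hvB : v ∉ B)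
    (huU : u ∈ U) (hvW : v ∈ W) (hUW : Disjoint U W)
    (hn : ∀ x ∈ U, ∀ y ∈ W, G.Adj x y → x = u ∧ y = v) (hS : (U ∪ W)ᶜ.ncard ≤ 2)
    (hU : ∃ x ∈ U, x ≠ u) (hW : ∃ x ∈ W, x ≠ v) : False := by
  have huW : u ∉ W := fun h => Set.disjoint_left.1 hUW huU h
  have hvU : v ∉ U := fun h => Set.disjoint_left.1 hUW h hvW
  have huv : u ≠ v := fun h => huW (h ▸ hvW)
  by_cases h1 : ∀ x ∈ W, x ≠ v → x ∈ A ∪ B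
  · exact crossing_half G hG hA hB hAB hnAB hT huA huB hvA hvB huU hvW hUW hn hS h1 hW
  by_cases h2 : ∀ x ∈ U, x ≠ u → x ∈ A ∪ B
  · exact crossing_half G hG hA hB hAB hnAB hT hvA hvB huA huB hvW huU hUW.symm
      (fun x hx y hy h => (hn y hy x hx h.symm).symm) (by rwa [Set.union_comm]) h2 hU
  push Not at h1 h2
  obtain ⟨x, hxW, hxv, hx⟩ := h1
  obtain ⟨y, hyU, hyu, hy⟩ := h2
  have hsub : ({u, v, x, y} : Set V) ⊆ (A ∪ B)ᶜ := by
    rintro z (rfl | rfl | rfl | rfl)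
    · exact fun h => h.elim huA huB
    · exact fun h => h.elim hvA hvB
    · exact hx
    · exact hy
  have hxy : x ≠ y := fun h => Set.disjoint_left.1 hUW hyU (h ▸ hxW)
  have hux : u ≠ x := fun h => huW (h ▸ hxW)
  have hvy : v ≠ y := fun h => hvU (h ▸ hyU)
  have h1 := Set.ncard_le_ncard hsub (Set.toFinite _)
  rw [Set.ncard_insert_of_notMem (by simp [huv, hux, hyu.symm]),
    Set.ncard_insert_of_notMem (by simp [hxv.symm, hvy]), Set.ncard_pair hxy] at h1
  omega

/-- Deleting a noncontractible edge only creates trivial 2-separations. -/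
lemma sep_delete [Finite V] (G : SimpleGraph V) (hG : ∀ P Q, ¬ Sep G P Q) {u v : V}
    (huv : u ≠ v) {P' Q' : Set {w : V // w ≠ v}} (hs : Sep (contractGraph G huv) P' Q')
    {P Q : Set V} (hPQ : Sep (G.deleteEdges {s(u, v)}) P Q) :
    (u ∈ P ∧ v ∈ Q ∨ v ∈ P ∧ u ∈ Q) ∧ (P = {u} ∨ P = {v} ∨ Q = {u} ∨ Q = {v}) := by
  obtain ⟨A, B, hA, hB, hAB, hnAB, hT, huA, huB, hvA, hvB⟩ := sep_noncontr G hG huv hs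
  obtain ⟨h1, h2, h3, h4, h5⟩ := hPQ
  have h4' : ∀ x ∈ P, ∀ y ∈ Q, G.Adj x y → s(x, y) = s(u, v) := by
    intro x hx y hy hxy
    by_contra hne
    exact h4 x hx y hy (by rw [deleteEdges_adj]; exact ⟨hxy, hne⟩)
  have hmem : u ∈ P ∧ v ∈ Q ∨ v ∈ P ∧ u ∈ Q := by
    by_contra hcon
    refine hG P Q ⟨h1, h2, h3, ?_, h5⟩
    intro x hx y hy hxy
    rcases Sym2.eq_iff.1 (h4' x hx y hy hxy) with ⟨rfl, rfl⟩ | ⟨rfl, rfl⟩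
    · exact hcon (Or.inl ⟨hx, hy⟩)
    · exact hcon (Or.inr ⟨hx, hy⟩)
  refine ⟨hmem, ?_⟩
  by_contra hcon
  push Not at hcon
  obtain ⟨c1, c2, c3, c4⟩ := hcon
  have hex : ∀ (S : Set V) (w : V), w ∈ S → S ≠ {w} → ∃ x ∈ S, x ≠ w := by
    intro S w hw hne
    by_contra hh
    push Not at hh
    exact hne (Set.eq_singleton_iff_unique_mem.2 ⟨hw, hh⟩)
  rcases hmem with ⟨hu, hv⟩ | ⟨hv, hu⟩
  · refine crossing G hG hA hB hAB hnAB hT huA huB hvA hvB hu hv h3 ?_ h5 (hex _ _ hu c1)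
      (hex _ _ hv c4)
    intro x hx y hy hxy
    rcases Sym2.eq_iff.1 (h4' x hx y hy hxy) with h | ⟨rfl, rfl⟩
    · exact h
    · exact absurd hu (Set.disjoint_right.1 h3 hy)
  · refine crossing G hG hA hB hAB hnAB hT huA huB hvA hvB hu hv h3.symm ?_
      (by rwa [Set.union_comm]) (hex _ _ hu c3) (hex _ _ hv c2)
    intro x hx y hy hxy
    rcases Sym2.eq_iff.1 (h4' y hy x hx hxy.symm) with ⟨rfl, rfl⟩ | ⟨rfl, rfl⟩
    · exact absurd hu (Set.disjoint_left.1 h3 hy)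
    · exact ⟨rfl, rfl⟩

end TCW

namespace TCW

variable {V : Type*}

/-- `G[X]` has at least `n` components. -/
def NC (X : Set (Sym2 V)) (n : ℕ) : Prop :=
  ∃ g : Fin n → V, (∀ i, g i ∈ (fromEdgeSet X).support) ∧
    ∀ i j, i ≠ j → ¬ (fromEdgeSet X).Reachable (g i) (g j)

/-- The constraint set after contraction. -/
def conX (X : Set (Sym2 V)) {u v : V} (h : u ≠ v) : Set (Sym2 {w : V // w ≠ v}) :=
  {e | e ∈ Sym2.map (contractFun h) '' X ∧ ¬ e.IsDiag}

lemma mem_supp (X : Set (Sym2 V)) (x : V) :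
    x ∈ (fromEdgeSet X).support ↔ ∃ y, s(x, y) ∈ X ∧ x ≠ y := by
  simp [mem_support]

lemma conX_adj (X : Set (Sym2 V)) {u v : V} (h : u ≠ v) (x y : {w : V // w ≠ v}) :
    (fromEdgeSet (conX X h)).Adj x y ↔
      x ≠ y ∧ ∃ s t, s(s, t) ∈ X ∧ contractFun h s = x ∧ contractFun h t = y := by
  rw [fromEdgeSet_adj]
  unfold conX
  rw [Set.mem_setOf_eq, mem_map_image, Sym2.mk_isDiag_iff]
  tauto

/-- Reachability after adding the edge `uv`. -/
def RR (X : Set (Sym2 V)) (u v x y : V) : Prop :=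
  (fromEdgeSet X).Reachable x y ∨
  ((fromEdgeSet X).Reachable x u ∧ (fromEdgeSet X).Reachable v y) ∨
  ((fromEdgeSet X).Reachable x v ∧ (fromEdgeSet X).Reachable u y)

lemma RR.trans {X : Set (Sym2 V)} {u v x y z : V} (h1 : RR X u v x y) (h2 : RR X u v y z) :
    RR X u v x z := by
  unfold RR at *
  have t : ∀ {a b c : V}, (fromEdgeSet X).Reachable a b → (fromEdgeSet X).Reachable b c →
    (fromEdgeSet X).Reachable a c := fun h h' => h.trans h'
  have s : ∀ {a b : V}, (fromEdgeSet X).Reachable a b → (fromEdgeSet X).Reachable b a :=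
    fun h => h.symm
  rcases h1 with h1 | ⟨h1, h1'⟩ | ⟨h1, h1'⟩ <;> rcases h2 with h2 | ⟨h2, h2'⟩ | ⟨h2, h2'⟩
  · exact Or.inl (t h1 h2)
  · exact Or.inr (Or.inl ⟨t h1 h2, h2'⟩)
  · exact Or.inr (Or.inr ⟨t h1 h2, h2'⟩)
  · exact Or.inr (Or.inl ⟨h1, t h1' h2⟩)
  · exact Or.inr (Or.inl ⟨h1, h2'⟩)
  · exact Or.inl (t h1 h2')
  · exact Or.inr (Or.inr ⟨h1, t h1' h2⟩)
  · exact Or.inl (t h1 h2')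
  · exact Or.inr (Or.inr ⟨h1, h2'⟩)

lemma RR_of_cf {X : Set (Sym2 V)} {u v : V} (h : u ≠ v) {x y : V}
    (hxy : contractFun h x = contractFun h y) : RR X u v x y := by
  rcases cf_eq h hxy with rfl | ⟨rfl, rfl⟩ | ⟨rfl, rfl⟩
  · exact Or.inl (Reachable.refl _)
  · exact Or.inr (Or.inl ⟨Reachable.refl _, Reachable.refl _⟩)
  · exact Or.inr (Or.inr ⟨Reachable.refl _, Reachable.refl _⟩)

lemma reach_con {X : Set (Sym2 V)} {u v : V} (h : u ≠ v) {x' y' : {w : V // w ≠ v}}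
    (hr : (fromEdgeSet (conX X h)).Reachable x' y') :
    ∀ x y, contractFun h x = x' → contractFun h y = y' → RR X u v x y := by
  obtain ⟨w⟩ := hr
  induction w with
  | nil => intro x y hx hy; exact RR_of_cf h (hx.trans hy.symm)
  | cons hadj _ ih =>
    intro x y hx hy
    obtain ⟨hne, s, t, hst, hs, ht⟩ := (conX_adj X h _ _).1 hadj
    have hst' : s ≠ t := fun he => hne (by rw [← hs, ← ht, he])
    have h1 : RR X u v x s := RR_of_cf h (hx.trans hs.symm)
    have h2 : RR X u v s t := Or.inl (Adj.reachable ((fromEdgeSet_adj X).2 ⟨hst, hst'⟩))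
    exact (h1.trans h2).trans (ih t y ht hy)

lemma supp_con {X : Set (Sym2 V)} {u v : V} (h : u ≠ v) {x y : V} (hxy : s(x, y) ∈ X)
    (hne : x ≠ y) (hf : s(x, y) ≠ s(u, v)) :
    contractFun h x ∈ (fromEdgeSet (conX X h)).support := by
  rw [mem_support]
  refine ⟨contractFun h y, (conX_adj X h _ _).2 ⟨?_, x, y, hxy, rfl, rfl⟩⟩
  intro he
  rcases cf_eq h he with e | ⟨rfl, rfl⟩ | ⟨rfl, rfl⟩
  · exact hne e
  · exact hf rfl
  · exact hf Sym2.eq_swap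

lemma NC_con {X : Set (Sym2 V)} {u v : V} (h : u ≠ v) {n : ℕ} (hX : NC X (n + 1)) :
    NC (conX X h) n := by
  obtain ⟨g, hg, hgr⟩ := hX
  have : ∃ i0, ∀ j, j ≠ i0 → ¬ (fromEdgeSet X).Reachable (g j) u := by
    by_cases hc : ∃ i, (fromEdgeSet X).Reachable (g i) u
    · obtain ⟨i, hi⟩ := hc
      exact ⟨i, fun j hj hr => hgr j i hj (hr.trans hi.symm)⟩
    · exact ⟨0, fun j _ hr => hc ⟨j, hr⟩⟩
  obtain ⟨i0, hi0⟩ := this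
  refine ⟨fun i => contractFun h (g (i0.succAbove i)), ?_, ?_⟩
  · intro i
    obtain ⟨y, hy, hne⟩ := (mem_supp X _).1 (hg (i0.succAbove i))
    refine supp_con h hy hne ?_
    intro he
    have hni := hi0 _ (Fin.succAbove_ne i0 i)
    rcases Sym2.eq_iff.1 he with ⟨h1, h2⟩ | ⟨h1, h2⟩
    · exact hni (h1 ▸ Reachable.refl _)
    · apply hni
      have : (fromEdgeSet X).Adj (g (i0.succAbove i)) y := (fromEdgeSet_adj X).2 ⟨hy, hne⟩
      exact h2 ▸ this.reachable
  · intro i j hij hr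
    rcases reach_con h hr _ _ rfl rfl with hr | ⟨hr, _⟩ | ⟨_, hr⟩
    · exact hgr _ _ (fun he => hij (Fin.succAbove_right_injective he)) hr
    · exact hi0 _ (Fin.succAbove_ne i0 i) hr
    · exact hi0 _ (Fin.succAbove_ne i0 j) hr.symm

/-- Contracting `uv` may reduce the number of components. -/
def Red (X : Set (Sym2 V)) (u v : V) : Prop :=
  (s(u, v) ∈ X ∧ ∀ x y, s(x, y) ∈ X → x ≠ y → (x = u ∨ x = v) → s(x, y) = s(u, v)) ∨
  (s(u, v) ∉ X ∧ u ∈ (fromEdgeSet X).support ∧ v ∈ (fromEdgeSet X).support)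

lemma NC_con_of_not_red {X : Set (Sym2 V)} {u v : V} (h : u ≠ v) {n : ℕ} (hX : NC X n)
    (hred : ¬ Red X u v) : NC (conX X h) n := by
  obtain ⟨g, hg, hgr⟩ := hX
  by_cases huv : s(u, v) ∈ X
  · have hex : ∃ x y, s(x, y) ∈ X ∧ x ≠ y ∧ (x = u ∨ x = v) ∧ s(x, y) ≠ s(u, v) := by
      by_contra hc
      push Not at hc
      exact hred (Or.inl ⟨huv, hc⟩)
    have hadj : (fromEdgeSet X).Reachable u v := Adj.reachable ((fromEdgeSet_adj X).2 ⟨huv, h⟩)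
    refine ⟨fun i => contractFun h (g i), ?_, ?_⟩
    · intro i
      obtain ⟨y, hy, hne⟩ := (mem_supp X _).1 (hg i)
      by_cases he : s(g i, y) = s(u, v)
      · obtain ⟨x, z, h1, h2, h3, h4⟩ := hex
        have := supp_con h h1 h2 h4
        have e1 : contractFun h u = contractFun h v := by rw [cf_self, cf_ne h h]
        have e2 : contractFun h (g i) = contractFun h u := by
          rcases Sym2.eq_iff.1 he with ⟨h1, h2⟩ | ⟨h1, h2⟩
          · rw [h1]
          · rw [h1, e1]
        have e3 : contractFun h x = contractFun h u := by
          rcases h3 with rfl | rfl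
          · rfl
          · rw [e1]
        show contractFun h (g i) ∈ _
        rw [e2, ← e3]
        exact this
      · exact supp_con h hy hne he
    · intro i j hij hr
      rcases reach_con h hr _ _ rfl rfl with hr | ⟨hr, hr'⟩ | ⟨hr, hr'⟩
      · exact hgr i j hij hr
      · exact hgr i j hij ((hr.trans hadj).trans hr')
      · exact hgr i j hij ((hr.trans hadj.symm).trans hr')
  · have hns : u ∉ (fromEdgeSet X).support ∨ v ∉ (fromEdgeSet X).support := by
      by_contra hc
      push Not at hc
      exact hred (Or.inr ⟨huv, hc⟩)
    have hiso : ∀ w, w ∉ (fromEdgeSet X).support → ∀ i, ¬ (fromEdgeSet X).Reachable w (g i) := by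
      intro w hw i hr
      have := reach_closed (fun z => z = w) (by
        rintro x y hxy rfl
        exact absurd ((mem_support _).2 ⟨y, hxy⟩) hw) hr rfl
      exact hw (this ▸ hg i)
    refine ⟨fun i => contractFun h (g i), ?_, ?_⟩
    · intro i
      obtain ⟨y, hy, hne⟩ := (mem_supp X _).1 (hg i)
      exact supp_con h hy hne (fun he => huv (he ▸ hy))
    · intro i j hij hr
      rcases reach_con h hr _ _ rfl rfl with hr | ⟨hr, hr'⟩ | ⟨hr, hr'⟩
      · exact hgr i j hij hr
      · rcases hns with hw | hw
        · exact hiso _ hw i hr.symm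
        · exact hiso _ hw j hr'
      · rcases hns with hw | hw
        · exact hiso _ hw j hr'
        · exact hiso _ hw i hr.symm

lemma NC_mono {X : Set (Sym2 V)} {m n : ℕ} (hmn : m ≤ n) (h : NC X n) : NC X m := by
  obtain ⟨g, h1, h2⟩ := h
  exact ⟨fun i => g (Fin.castLE hmn i), fun i => h1 _, fun i j hij => h2 _ _
    (fun he => hij (Fin.castLE_injective hmn he))⟩

lemma not_conn_of_NC {X : Set (Sym2 V)} (h : NC X 2) : ¬ EdgeSetConnected X := by
  obtain ⟨g, h1, h2⟩ := h
  exact fun hc => h2 0 1 (by decide) (hc _ (h1 0) _ (h1 1))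

lemma reach_induce {X : Set (Sym2 V)} {x y : V} (hr : (fromEdgeSet X).Reachable x y) :
    ∀ (hx : x ∈ (fromEdgeSet X).support) (hy : y ∈ (fromEdgeSet X).support),
      (edgeSubgraph X).Reachable ⟨x, hx⟩ ⟨y, hy⟩ := by
  obtain ⟨w⟩ := hr
  induction w with
  | nil => intro _ _; exact Reachable.refl _
  | @cons a b c hadj _ ih =>
    intro hx hy
    have hb : b ∈ (fromEdgeSet X).support := (mem_support _).2 ⟨a, hadj.symm⟩
    have : (edgeSubgraph X).Adj ⟨a, hx⟩ ⟨b, hb⟩ := hadj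
    exact this.reachable.trans (ih hb hy)

lemma NC_three [Finite V] {X : Set (Sym2 V)} (hnc : ¬ EdgeSetConnected X)
    (hne : edgeComponents X ≠ 2) : NC X 3 := by
  unfold edgeComponents at hne
  haveI : Finite (edgeSubgraph X).ConnectedComponent := Quot.finite _
  have h2 : 2 ≤ Nat.card (edgeSubgraph X).ConnectedComponent := by
    by_contra hlt
    have hle : Nat.card (edgeSubgraph X).ConnectedComponent ≤ 1 := by omega
    haveI := Finite.card_le_one_iff_subsingleton.1 hle
    apply hnc
    intro u hu v hv
    have he : (edgeSubgraph X).connectedComponentMk ⟨u, hu⟩ =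
      (edgeSubgraph X).connectedComponentMk ⟨v, hv⟩ := Subsingleton.elim _ _
    have hr := ConnectedComponent.exact he
    exact hr.map (Embedding.induce _).toHom
  have h3 : 3 ≤ Nat.card (edgeSubgraph X).ConnectedComponent := by omega
  let e := Finite.equivFin (edgeSubgraph X).ConnectedComponent
  refine ⟨fun i => ((e.symm (Fin.castLE h3 i)).out).1, fun i => ((e.symm (Fin.castLE h3 i)).out).2, ?_⟩
  intro i j hij hr
  have := reach_induce hr (Subtype.property _) (Subtype.property _)
  have h4 := ConnectedComponent.sound this
  apply hij
  have h5 : e.symm (Fin.castLE h3 i) = e.symm (Fin.castLE h3 j) := by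
    rw [← Quot.out_eq (e.symm (Fin.castLE h3 i)), ← Quot.out_eq (e.symm (Fin.castLE h3 j))]
    exact h4
  exact Fin.castLE_injective h3 (e.symm.injective h5)

lemma card_of_NC [Finite V] {X : Set (Sym2 V)} (h : NC X 3) : 6 ≤ Nat.card V := by
  obtain ⟨g, h1, h2⟩ := h
  choose p hp hpne using fun i => (mem_supp X _).1 (h1 i)
  have hr : ∀ i, (fromEdgeSet X).Reachable (g i) (p i) := fun i =>
    Adj.reachable ((fromEdgeSet_adj X).2 ⟨hp i, hpne i⟩)
  let f : Fin 3 × Bool → V := fun x => if x.2 then g x.1 else p x.1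
  have hf : ∀ x, (fromEdgeSet X).Reachable (g x.1) (f x) := by
    rintro ⟨i, b⟩
    cases b
    · exact hr i
    · exact Reachable.refl _
  have hinj : Function.Injective f := by
    rintro ⟨i, b⟩ ⟨j, c⟩ hxy
    have hij : i = j := by
      by_contra hne
      refine h2 i j hne ((hf (i, b)).trans ?_)
      rw [hxy]
      exact (hf (j, c)).symm
    subst hij
    cases b <;> cases c
    · rfl
    · exact absurd hxy (hpne i).symm
    · exact absurd hxy (hpne i)
    · rfl
  have := Nat.card_le_card_of_injective f hinj
  simpa using this

end TCW

namespace TCW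

section
variable {V : Type*}

lemma card_sub [Finite V] (v : V) : Nat.card V = Nat.card {w : V // w ≠ v} + 1 := by
  classical
  rw [← Finite.card_option, Nat.card_congr (Equiv.optionSubtypeNe v)]

lemma deg_three [Finite V] (G : SimpleGraph V) (hc : 3 < Nat.card V) (hG : ∀ P Q, ¬ Sep G P Q)
    (u : V) : 3 ≤ (G.neighborSet u).ncard := by
  by_contra hlt
  have h1 : (insert u (G.neighborSet u)).ncard ≤ 3 := by
    have := Set.ncard_insert_le u (G.neighborSet u)
    omega
  have hne : ((insert u (G.neighborSet u))ᶜ).Nonempty := by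
    by_contra hcon
    rw [Set.not_nonempty_iff_eq_empty, Set.compl_empty_iff] at hcon
    rw [hcon, Set.ncard_univ] at h1
    omega
  refine hG {u} (insert u (G.neighborSet u))ᶜ ⟨⟨u, rfl⟩, hne, ?_, ?_, ?_⟩
  · rw [Set.disjoint_left]
    rintro x rfl hx
    exact hx (Or.inl rfl)
  · rintro x rfl y hy hxy
    exact hy (Or.inr hxy)
  · have hsub : ({u} ∪ (insert u (G.neighborSet u))ᶜ)ᶜ ⊆ G.neighborSet u := by
      intro z hz
      by_contra hh
      apply hz
      by_cases hzu : z = u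
      · exact Or.inl hzu
      · exact Or.inr (fun h' => h'.elim hzu hh)
    have := Set.ncard_le_ncard hsub (Set.toFinite _)
    omega

/-- The neighbours of `u` are precisely `v`, `a`, `b`. -/
def D3 (G : SimpleGraph V) (u v a b : V) : Prop :=
  a ≠ b ∧ a ≠ v ∧ b ≠ v ∧ G.Adj u a ∧ G.Adj u b ∧ ∀ x, G.Adj u x → x = v ∨ x = a ∨ x = b

lemma D3.swap {G : SimpleGraph V} {u v a b : V} (h : D3 G u v a b) : D3 G u v b a := by
  obtain ⟨h1, h2, h3, h4, h5, h6⟩ := h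
  exact ⟨h1.symm, h3, h2, h5, h4, fun x hx => by have := h6 x hx; tauto⟩

lemma d3_of_sep [Finite V] (G : SimpleGraph V) (hdeg : ∀ u, 3 ≤ (G.neighborSet u).ncard)
    {u v : V} (huv : G.Adj u v) {Q : Set V}
    (hs : Sep (G.deleteEdges {s(u, v)}) {u} Q) : ∃ a b, D3 G u v a b := by
  obtain ⟨_, _, _, h4, h5⟩ := hs
  have hsub : G.neighborSet u \ {v} ⊆ ({u} ∪ Q)ᶜ := by
    rintro x ⟨hx, hxv⟩ (hxu | hxQ)
    · exact hx.ne hxu.symm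
    · refine h4 u rfl x hxQ ?_
      rw [deleteEdges_adj]
      refine ⟨hx, fun he => hxv ?_⟩
      rcases Sym2.eq_iff.1 he with ⟨_, h⟩ | ⟨h, h'⟩
      · exact h
      · exact h'.trans h
  have h6 := Set.ncard_le_ncard hsub (Set.toFinite _)
  have h7 := Set.ncard_sdiff_singleton_add_one (s := G.neighborSet u) (a := v) huv (Set.toFinite _)
  have h8 := hdeg u
  obtain ⟨a, b, hab, he⟩ := Set.ncard_eq_two.1 (show (G.neighborSet u \ {v}).ncard = 2 by omega)
  have ha : a ∈ G.neighborSet u \ {v} := by rw [he]; simp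
  have hb : b ∈ G.neighborSet u \ {v} := by rw [he]; simp
  refine ⟨a, b, hab, ha.2, hb.2, ha.1, hb.1, fun x hx => ?_⟩
  by_cases hxv : x = v
  · exact Or.inl hxv
  · have : x ∈ G.neighborSet u \ {v} := ⟨hx, hxv⟩
    rw [he] at this
    exact Or.inr this

lemma D3.del {G : SimpleGraph V} {u v a b : V} (h : D3 G u v a b) :
    (G.deleteEdges {s(u, v)}).Adj a u ∧ (G.deleteEdges {s(u, v)}).Adj u b ∧
      (∀ x, (G.deleteEdges {s(u, v)}).Adj u x → x = a ∨ x = b) := by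
  obtain ⟨h1, h2, h3, h4, h5, h6⟩ := h
  simp only [deleteEdges_adj, Set.mem_singleton_iff]
  refine ⟨⟨h4.symm, fun he => ?_⟩, ⟨h5, fun he => ?_⟩, fun x hx => ?_⟩
  · rcases Sym2.eq_iff.1 he with ⟨h, _⟩ | ⟨h, _⟩
    · exact h4.ne h.symm
    · exact h2 h
  · rcases Sym2.eq_iff.1 he with ⟨_, h⟩ | ⟨_, h⟩
    · exact h3 h
    · exact h5.ne h.symm
  · rcases h6 x hx.1 with rfl | h
    · exact absurd rfl hx.2
    · exact h

lemma one_contr [Finite V] (G : SimpleGraph V) {u v a b : V}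
    (hu : D3 G u v a b) (hau : a ≠ u) (P' Q' : Set {w : V // w ≠ u})
    (hs : Sep (contractGraph (G.deleteEdges {s(u, v)}) hau) P' Q') :
    ∃ P Q, Sep (G.deleteEdges {s(u, v)}) P Q ∧ (∃ x ∈ P, x ≠ u) ∧ ∃ x ∈ Q, x ≠ u := by
  obtain ⟨e1, e2, e3⟩ := hu.del
  obtain ⟨P, Q, hPQ, hP, hQ⟩ := sep_lift _ hau e2.ne.symm e2 e3 hs
  obtain ⟨⟨p, hp⟩, ⟨q, hq⟩, _⟩ := hs
  exact ⟨P, Q, hPQ, ⟨p, hP ⟨p, hp, rfl⟩, p.2⟩, ⟨q, hQ ⟨q, hq, rfl⟩, q.2⟩⟩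

lemma two_contr [Finite V] (G : SimpleGraph V) {u v a b c d : V} (hv' : v ≠ u) (hc' : c ≠ u)
    (hu : D3 G u v a b) (hv : D3 G v u c d) (hau : a ≠ u) :
    (contractGraph (G.deleteEdges {s(u, v)}) hau).Adj ⟨c, hc'⟩ ⟨v, hv'⟩ ∧
      ∀ (hcv : (⟨c, hc'⟩ : {w : V // w ≠ u}) ≠ ⟨v, hv'⟩) (P' Q'),
      Sep (contractGraph (contractGraph (G.deleteEdges {s(u, v)}) hau) hcv) P' Q' →
      ∃ P Q, Sep (G.deleteEdges {s(u, v)}) P Q ∧ (∃ x ∈ P, x ≠ u ∧ x ≠ v) ∧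
        ∃ x ∈ Q, x ≠ u ∧ x ≠ v := by
  obtain ⟨e1, e2, e3⟩ := hu.del
  have hvd := hv.del
  rw [Sym2.eq_swap] at hvd
  obtain ⟨f1, f2, f3⟩ := hvd
  obtain ⟨h1, h2, h3, h4, h5, h6⟩ := hu
  obtain ⟨k1, k2, k3, k4, k5, k6⟩ := hv
  refine ⟨contract_adj_of _ hau _ _ f1, ?_⟩
  intro hcv P' Q' hs
  have hdv : (⟨d, k3⟩ : {w : V // w ≠ u}) ≠ ⟨v, hv'⟩ := fun he =>
    f2.ne (congrArg Subtype.val he).symm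
  obtain ⟨P1, Q1, hs1, hP1, hQ1⟩ := sep_lift _ hcv hdv (contract_adj_of _ hau hv' k3 f2) (by
    intro x hx
    obtain ⟨_, s, t, hst, hs, ht⟩ := (contract_adj _ _ _ _).1 hx
    have hs' : s = v := by
      by_cases hsu : s = u
      · subst hsu
        rw [cf_self] at hs
        exact absurd (congrArg Subtype.val hs) h2
      · rw [cf_ne hau hsu] at hs
        exact congrArg Subtype.val hs
    subst hs'
    rcases f3 t hst with rfl | rfl
    · left; rw [← ht, cf_ne]
    · right; rw [← ht, cf_ne]) hs
  obtain ⟨P, Q, hPQ, hP, hQ⟩ := sep_lift _ hau e2.ne.symm e2 e3 hs1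
  obtain ⟨⟨p, hp⟩, ⟨q, hq⟩, _⟩ := hs
  exact ⟨P, Q, hPQ, ⟨p.1, hP ⟨p, hP1 ⟨p, hp, rfl⟩, rfl⟩, p.1.2, fun he => p.2 (Subtype.ext he)⟩,
    ⟨q.1, hQ ⟨q, hQ1 ⟨q, hq, rfl⟩, rfl⟩, q.1.2, fun he => q.2 (Subtype.ext he)⟩⟩

end

lemma bad_self {C : CGraph} (h : KConnected 3 C.G) (hX : NC C.X 2) : BadMinor C :=
  ⟨C, Relation.ReflTransGen.refl, h, not_conn_of_NC hX⟩

lemma bad_contr {C : CGraph} {a u : C.V} (h : C.G.Adj a u) (hb : BadMinor (C.contract a u h.ne)) :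
    BadMinor C := by
  obtain ⟨D, h1, h2⟩ := hb
  exact ⟨D, Relation.ReflTransGen.head (CMinorStep.contr C a u h) h1, h2⟩

lemma noncontr (C : CGraph) (h3 : KConnected 3 C.G) (hX : NC C.X 3) {u v : C.V}
    (hadj : C.G.Adj u v) (hess : Essential C s(u, v)) :
    ∃ P' Q', Sep (contractGraph C.G hadj.ne) P' Q' := by
  by_contra hcon
  push Not at hcon
  apply hess.2 u v hadj rfl
  refine bad_self ((kconn_iff _).2 ⟨?_, hcon⟩) (NC_con hadj.ne hX)
  have := card_of_NC hX
  have h := card_sub v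
  show 3 < Nat.card {w : C.V // w ≠ v}
  omega

lemma key (C : CGraph) (h3 : KConnected 3 C.G) (hX : NC C.X 3) {u v : C.V}
    (hadj : C.G.Adj u v) (hess : Essential C s(u, v)) :
    ∃ a b, D3 C.G u v a b ∧ Red C.X a u ∧ Red C.X b u ∧ ¬ NC C.X 4 := by
  obtain ⟨hc, hG⟩ := (kconn_iff _).1 h3
  have hdeg := deg_three C.G hc hG
  have h6 := card_of_NC hX
  have hX2 : NC C.X 2 := NC_mono (by omega) hX
  obtain ⟨P0, Q0, hs0⟩ := noncontr C h3 hX hadj hess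
  have hdel : ∀ P Q, Sep (C.G.deleteEdges {s(u, v)}) P Q → _ :=
    fun P Q hPQ => (sep_delete C.G hG hadj.ne hs0 hPQ).2
  have hbad := hess.1
  have hswap : s(u, v) = s(v, u) := Sym2.eq_swap
  have hcu := card_sub u
  have hcv := card_sub v
  have fromU : ∀ Q, Sep (C.G.deleteEdges {s(u, v)}) {u} Q → ∃ a b, D3 C.G u v a b :=
    fun Q hQ => d3_of_sep C.G hdeg hadj hQ
  have fromV : ∀ Q, Sep (C.G.deleteEdges {s(u, v)}) {v} Q → ∃ a b, D3 C.G v u a b :=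
    fun Q hQ => d3_of_sep C.G hdeg hadj.symm (hswap ▸ hQ)
  have hD : ∃ a b, D3 C.G u v a b := by
    by_contra hnu
    apply hbad
    by_cases hv : ∃ c d, D3 C.G v u c d
    · obtain ⟨c, d, hv⟩ := hv
      have hvd := hv.del.1
      have hone := one_contr C.G hv hv.2.2.2.1.ne.symm
      rw [← hswap] at hvd hone
      refine bad_contr (C := C.deleteEdge s(u, v)) (a := c) (u := v) hvd ?_
      refine bad_self ((kconn_iff _).2 ⟨?_, ?_⟩) (NC_con _ hX)
      · show 3 < Nat.card {w : C.V // w ≠ v}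
        omega
      · intro P' Q' hs
        obtain ⟨P, Q, hPQ, ⟨x, hx, hxv⟩, ⟨y, hy, hyv⟩⟩ := hone P' Q' hs
        rcases hdel P Q hPQ with rfl | rfl | rfl | rfl
        · exact hnu (fromU _ hPQ)
        · exact hxv hx
        · exact hnu (fromU _ hPQ.symm)
        · exact hyv hy
    · refine bad_self ((kconn_iff _).2 ⟨hc, ?_⟩) hX2
      intro P Q hPQ
      rcases hdel P Q hPQ with rfl | rfl | rfl | rfl
      · exact hnu (fromU _ hPQ)
      · exact hv (fromV _ hPQ)
      · exact hnu (fromU _ hPQ.symm)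
      · exact hv (fromV _ hPQ.symm)
  obtain ⟨a, b, hab⟩ := hD
  have hred : ∀ a b, D3 C.G u v a b → ∀ (hau : a ≠ u),
      NC (conX C.X hau) 3 → False := by
    intro a b hab hau hN
    apply hbad
    have hud := hab.del.1
    refine bad_contr (C := C.deleteEdge s(u, v)) (a := a) (u := u) hud ?_
    by_cases hv : ∃ c d, D3 C.G v u c d
    · obtain ⟨c, d, hv⟩ := hv
      obtain ⟨g1, g2⟩ := two_contr C.G hadj.ne.symm hv.2.1 hab hv hau
      refine bad_contr (C := (C.deleteEdge s(u, v)).contract a u hud.ne) (a := ⟨c, hv.2.1⟩)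
        (u := ⟨v, hadj.ne.symm⟩) g1 ?_
      refine bad_self ((kconn_iff _).2 ⟨?_, ?_⟩) (NC_con _ hN)
      · show 3 < Nat.card {w : {w : C.V // w ≠ u} // w ≠ ⟨v, hadj.ne.symm⟩}
        have := card_sub (⟨v, hadj.ne.symm⟩ : {w : C.V // w ≠ u})
        omega
      · intro P' Q' hs
        obtain ⟨P, Q, hPQ, ⟨x, hx, hxu, hxv⟩, ⟨y, hy, hyu, hyv⟩⟩ := g2 _ P' Q' hs
        rcases hdel P Q hPQ with rfl | rfl | rfl | rfl
        · exact hxu hx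
        · exact hxv hx
        · exact hyu hy
        · exact hyv hy
    · refine bad_self ((kconn_iff _).2 ⟨?_, ?_⟩) (NC_mono (by omega) hN)
      · show 3 < Nat.card {w : C.V // w ≠ u}
        omega
      · intro P' Q' hs
        obtain ⟨P, Q, hPQ, ⟨x, hx, hxv⟩, ⟨y, hy, hyv⟩⟩ := one_contr C.G hab hau P' Q' hs
        rcases hdel P Q hPQ with rfl | rfl | rfl | rfl
        · exact hxv hx
        · exact hv (fromV _ hPQ)
        · exact hyv hy
        · exact hv (fromV _ hPQ.symm)
  have hau : a ≠ u := hab.2.2.2.1.ne.symm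
  have hbu : b ≠ u := hab.2.2.2.2.1.ne.symm
  refine ⟨a, b, hab, ?_, ?_, ?_⟩
  · by_contra hr
    exact hred a b hab hau (NC_con_of_not_red hau hX hr)
  · by_contra hr
    exact hred b a hab.swap hbu (NC_con_of_not_red hbu hX hr)
  · intro h4
    exact hred a b hab hau (NC_con hau h4)

end TCW

namespace TCW

lemma step1 (C : CGraph) (hWF : C.WF) (h3 : KConnected 3 C.G) (hX : NC C.X 3) {u v : C.V}
    (hadj : C.G.Adj u v) (hx : s(u, v) ∉ C.X) (hess : Essential C s(u, v)) :
    ∃ a b, D3 C.G u v a b ∧ s(u, a) ∈ C.X ∧ s(u, b) ∉ C.X ∧ (∀ y, s(a, y) ∈ C.X → y = u) ∧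
      ¬ NC C.X 4 := by
  have hne : ∀ x y, s(x, y) ∈ C.X → x ≠ y := fun x y h => (show C.G.Adj x y from hWF h).ne
  have main : ∀ a b, D3 C.G u v a b → Red C.X a u → Red C.X b u → s(u, a) ∈ C.X →
      s(u, b) ∉ C.X ∧ (∀ y, s(a, y) ∈ C.X → y = u) := by
    intro a b hab ha hb hua
    have hau : s(a, u) ∈ C.X := by rwa [Sym2.eq_swap]
    rcases ha with ⟨_, ha⟩ | ⟨ha, _⟩
    · constructor
      · intro hub
        rcases Sym2.eq_iff.1 (ha u b hub (hne _ _ hub) (Or.inr rfl)) with ⟨h1, h2⟩ | ⟨_, h2⟩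
        · exact hab.2.2.2.1.ne h1
        · exact hab.1 h2.symm
      · intro y hy
        rcases Sym2.eq_iff.1 (ha a y hy (hne _ _ hy) (Or.inl rfl)) with ⟨_, h2⟩ | ⟨h1, _⟩
        · exact h2
        · exact absurd h1.symm hab.2.2.2.1.ne
    · exact absurd hau ha
  obtain ⟨a, b, hab, ha, hb, h4⟩ := key C h3 hX hadj hess
  by_cases hua : s(u, a) ∈ C.X
  · obtain ⟨m1, m2⟩ := main a b hab ha hb hua
    exact ⟨a, b, hab, hua, m1, m2, h4⟩
  by_cases hub : s(u, b) ∈ C.X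
  · obtain ⟨m1, m2⟩ := main b a hab.swap hb ha hub
    exact ⟨b, a, hab.swap, hub, m1, m2, h4⟩
  exfalso
  rcases ha with ⟨ha, _⟩ | ⟨_, _, hs⟩
  · exact hua (by rwa [Sym2.eq_swap])
  · obtain ⟨y, hy, _⟩ := (mem_supp _ _).1 hs
    rcases hab.2.2.2.2.2 y (hWF hy) with rfl | rfl | rfl
    · exact hx hy
    · exact hua hy
    · exact hub hy

lemma exists_nonX {V : Type*} [Finite V] (G : SimpleGraph V) (X : Set (Sym2 V))
    (h3 : KConnected 3 G) (hX : NC X 3) : ∃ u v, G.Adj u v ∧ s(u, v) ∉ X := by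
  by_contra hcon
  push Not at hcon
  obtain ⟨g, _, h2⟩ := hX
  have hc := (h3.2 ∅ (by simp)).preconnected ⟨g 0, by simp⟩ ⟨g 1, by simp⟩
  have := reach_closed (fun z => (fromEdgeSet X).Reachable (g 0) z.1) (by
    intro x y hxy hx
    have hxy' : G.Adj x.1 y.1 := hxy
    exact hx.trans (Adj.reachable ((fromEdgeSet_adj X).2 ⟨hcon _ _ hxy', hxy'.ne⟩))) hc
    (Reachable.refl _)
  exact h2 0 1 (by decide) this

/-- Every vertex meets an edge outside `X`. -/
lemma all_nonX (C : CGraph) (hWF : C.WF) (h3 : KConnected 3 C.G) (hX : NC C.X 3)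
    (hess : ∀ e ∈ C.G.edgeSet, e ∉ C.X → Essential C e) :
    ∀ u, ∃ v, C.G.Adj u v ∧ s(u, v) ∉ C.X := by
  obtain ⟨u0, v0, h0, h0'⟩ := exists_nonX C.G C.X h3 hX
  obtain ⟨hc, hG⟩ := (kconn_iff _).1 h3
  have hdeg := deg_three C.G hc hG
  intro u
  have hr := (h3.2 ∅ (by simp)).preconnected ⟨u0, by simp⟩ ⟨u, by simp⟩
  refine reach_closed (fun z => ∃ v, C.G.Adj z.1 v ∧ s(z.1, v) ∉ C.X) ?_ hr ⟨v0, h0, h0'⟩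
  rintro ⟨x, _⟩ ⟨y, _⟩ hxy ⟨v, hv, hv'⟩
  have hxy' : C.G.Adj x y := hxy
  by_cases hX' : s(x, y) ∈ C.X
  · obtain ⟨a, b, hab, h1, h2, h5, _⟩ := step1 C hWF h3 hX hv hv' (hess _ hv hv')
    have hya : y = a := by
      rcases hab.2.2.2.2.2 y hxy' with rfl | rfl | rfl
      · exact absurd hX' hv'
      · rfl
      · exact absurd hX' h2
    subst hya
    by_contra hcon
    push Not at hcon
    have hsub : C.G.neighborSet y ⊆ {x} := fun z hz => h5 z (hcon z hz)
    have := Set.ncard_le_ncard hsub (Set.toFinite _)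
    rw [Set.ncard_singleton] at this
    have := hdeg y
    omega
  · exact ⟨x, hxy'.symm, by rwa [Sym2.eq_swap]⟩

section
variable {V : Type*}

lemma tri [Finite V] (G : SimpleGraph V) (h6 : Nat.card V ≤ 6) (hG : ∀ P Q, ¬ Sep G P Q)
    (hdeg : ∀ u, 3 ≤ (G.neighborSet u).ncard) {u v : V} (huv : u ≠ v)
    {P' Q' : Set {w : V // w ≠ v}} (hs : Sep (contractGraph G huv) P' Q') :
    ∃ t, G.Adj t u ∧ G.Adj t v := by
  have main : ∀ A B : Set V, A.Nonempty → (∀ x ∈ A, ∀ y ∈ B, ¬ G.Adj x y) →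
      (A ∪ B)ᶜ.ncard ≤ 3 → u ∉ A → u ∉ B → v ∉ A → v ∉ B → A.ncard ≤ 1 →
      ∃ t, G.Adj t u ∧ G.Adj t v := by
    rintro A B ⟨t, ht⟩ hn hc huA huB hvA hvB h1
    have hA : ∀ x ∈ A, x = t := fun x hx => (Set.ncard_le_one (Set.toFinite A)).1 h1 x hx t ht
    have hsub : G.neighborSet t ⊆ (A ∪ B)ᶜ := by
      rintro x hx (h | h)
      · exact (show G.Adj t x from hx).ne (hA x h).symm
      · exact hn t ht x h hx
    have he := Set.eq_of_subset_of_ncard_le hsub (hc.trans (hdeg t)) (Set.toFinite _)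
    refine ⟨t, ?_, ?_⟩
    · show u ∈ G.neighborSet t
      rw [he]; exact fun h => h.elim huA huB
    · show v ∈ G.neighborSet t
      rw [he]; exact fun h => h.elim hvA hvB
  obtain ⟨A, B, hA, hB, hAB, hnAB, hT, huA, huB, hvA, hvB⟩ := sep_noncontr G hG huv hs
  have h3 : ¬ (A ∪ B)ᶜ.ncard ≤ 2 := fun h => hG A B ⟨hA, hB, hAB, hnAB, h⟩
  have e1 := Set.ncard_add_ncard_compl (A ∪ B)
  have e2 := Set.ncard_union_eq hAB (Set.toFinite _) (Set.toFinite _)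
  by_cases h : A.ncard ≤ 1
  · exact main A B hA hnAB hT huA huB hvA hvB h
  · exact main B A hB (fun x hx y hy hxy => hnAB y hy x hx hxy.symm)
      (by rwa [Set.union_comm]) huB huA hvB hvA (by omega)

/-- Final structural analysis. -/
lemma finish [Finite V] (G : SimpleGraph V) (X : Set (Sym2 V)) (p : V → V)
    (hG : ∀ P Q, ¬ Sep G P Q) (hc : 6 ≤ Nat.card V)
    (hp : ∀ x y, s(x, y) ∈ X ↔ y = p x) (hpG : ∀ x, G.Adj x (p x))
    (hN : ∀ u v, G.Adj u v → s(u, v) ∉ X → ∃ b, D3 G u v (p u) b ∧ s(u, b) ∉ X)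
    (htri : ∀ u v, G.Adj u v → s(u, v) ∉ X → ∃ t, G.Adj t u ∧ G.Adj t v)
    (hcov : ∀ x y z, y ≠ x → y ≠ p x → z ≠ x → z ≠ p x → z ≠ y → z ≠ p y →
      ∀ w, w = x ∨ w = y ∨ w = z ∨ w = p x ∨ w = p y ∨ w = p z)
    (hex : ∃ u v, G.Adj u v ∧ s(u, v) ∉ X) :
    ∃ f : Fin 6 → V, Function.Bijective f ∧ (∀ i j, prismGraph.Adj i j ↔ G.Adj (f i) (f j)) ∧
      X = Sym2.map f '' weirdPrism.X := by
  have hpp : ∀ x, p (p x) = x := by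
    intro x
    have h1 : s(x, p x) ∈ X := (hp _ _).2 rfl
    rw [Sym2.eq_swap] at h1
    exact ((hp _ _).1 h1).symm
  have hsw : ∀ {x y}, s(x, y) ∉ X → s(y, x) ∉ X := fun h => by rwa [Sym2.eq_swap]
  -- triangles through edges outside `X` avoid `X`
  have htri' : ∀ u v t, G.Adj u v → s(u, v) ∉ X → G.Adj t u → G.Adj t v → s(u, t) ∉ X := by
    intro u v t huv hX htu htv hut
    have ht : t = p u := (hp _ _).1 hut
    have hu : u = p t := by rw [ht, hpp]
    have htvX : s(t, v) ∉ X := fun h => huv.ne (hu.trans ((hp _ _).1 h).symm)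
    obtain ⟨z, hz, hzX⟩ := hN u v huv hX
    obtain ⟨w, hw, hwX⟩ := hN t v htv htvX
    rw [← ht] at hz
    rw [← hu] at hw
    obtain ⟨z1, z2, z3, z4, z5, z6⟩ := hz
    obtain ⟨w1, w2, w3, w4, w5, w6⟩ := hw
    have hwz : w ≠ z := by
      rintro rfl
      have hcard : ({u, t, v, w} : Set V).ncard ≤ 4 := by
        have e1 := Set.ncard_insert_le u {t, v, w}
        have e2 := Set.ncard_insert_le t {v, w}
        have e3 := Set.ncard_insert_le v {w}
        rw [Set.ncard_singleton] at e3
        omega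
      have hne : (({u, t, v, w} : Set V)ᶜ).Nonempty := by
        by_contra hcon
        rw [Set.not_nonempty_iff_eq_empty, Set.compl_empty_iff] at hcon
        rw [hcon, Set.ncard_univ] at hcard
        omega
      refine hG {u, t} ({u, t, v, w} : Set V)ᶜ ⟨⟨u, by simp⟩, hne, ?_, ?_, ?_⟩
      · rw [Set.disjoint_left]
        rintro x (rfl | rfl) hx <;> simp at hx
      · rintro x (rfl | rfl) y hy hxy
        · apply hy
          rcases z6 y hxy with rfl | rfl | rfl <;> simp
        · apply hy
          rcases w6 y hxy with rfl | rfl | rfl <;> simp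
      · have hsub : (({u, t} : Set V) ∪ ({u, t, v, w} : Set V)ᶜ)ᶜ ⊆ {v, w} := by
          intro x hx
          simp at hx ⊢
          tauto
        have := Set.ncard_le_ncard hsub (Set.toFinite _)
        have := Set.ncard_insert_le v {w}
        rw [Set.ncard_singleton] at this
        omega
    have hvw : G.Adj v w := by
      obtain ⟨y, y1, y2⟩ := htri t w w5 hwX
      rcases w6 y y1.symm with rfl | rfl | rfl
      · exact y2
      · rcases z6 w y2 with h | h | h
        · exact absurd h w3
        · exact absurd h w5.ne.symm
        · exact absurd h hwz
      · exact absurd rfl y2.ne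
    have hvz : G.Adj v z := by
      obtain ⟨y, y1, y2⟩ := htri u z z5 hzX
      rcases z6 y y1.symm with rfl | rfl | rfl
      · exact y2
      · rcases w6 z y2 with h | h | h
        · exact absurd h z3
        · exact absurd h z5.ne.symm
        · exact absurd h.symm hwz
      · exact absurd rfl y2.ne
    obtain ⟨b, hb, _⟩ := hN v u huv.symm (hsw hX)
    obtain ⟨b1, b2, b3, b4, b5, b6⟩ := hb
    have c1 := b6 t htv.symm
    have c2 := b6 w hvw
    have c3 := b6 z hvz
    have d1 : t ≠ u := htu.ne
    have d2 : w ≠ u := w1.symm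
    have d3 : z ≠ u := z5.ne.symm
    have d4 : w ≠ t := w5.ne.symm
    have d5 : z ≠ t := z1.symm
    rcases c1 with c1 | c1 | c1 <;> rcases c2 with c2 | c2 | c2 <;> rcases c3 with c3 | c3 | c3 <;>
      first
      | exact d1 c1
      | exact d2 c2
      | exact d3 c3
      | exact d4 (c2.trans c1.symm)
      | exact d5 (c3.trans c1.symm)
      | exact hwz (c2.trans c3.symm)
  obtain ⟨u, v, huv, huvX⟩ := hex
  obtain ⟨t, htu, htv⟩ := htri u v huv huvX
  have hutX := htri' u v t huv huvX htu htv
  have hvtX := htri' v u t huv.symm (hsw huvX) htv htu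
  -- neighbourhoods of triangle vertices
  have nb : ∀ x y z, G.Adj x y → G.Adj x z → y ≠ z → s(x, y) ∉ X → s(x, z) ∉ X →
      ∀ w, G.Adj x w → w = y ∨ w = z ∨ w = p x := by
    intro x y z hxy hxz hyz hX1 hX2 w hw
    obtain ⟨b, hb, _⟩ := hN x y hxy hX1
    obtain ⟨b1, b2, b3, b4, b5, b6⟩ := hb
    have hz : z = b := by
      rcases b6 z hxz with h | h | h
      · exact absurd h.symm hyz
      · exact absurd ((hp _ _).2 h) hX2
      · exact h
    have := b6 w hw
    rw [← hz] at this
    tauto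
  have nu := nb u v t huv htu.symm htv.ne.symm huvX hutX
  have nv := nb v u t huv.symm htv.symm htu.ne.symm (hsw huvX) hvtX
  have nt := nb t u v htu htv huv.ne (hsw hutX) (hsw hvtX)
  have uv := huv.ne
  have ut := htu.ne.symm
  have vt := htv.ne.symm
  have vpu : v ≠ p u := fun h => huvX ((hp _ _).2 h)
  have tpu : t ≠ p u := fun h => hutX ((hp _ _).2 h)
  have tpv : t ≠ p v := fun h => hvtX ((hp _ _).2 h)
  have upv : u ≠ p v := fun h => hsw huvX ((hp _ _).2 h)
  have upt : u ≠ p t := fun h => hsw hutX ((hp _ _).2 h)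
  have vpt : v ≠ p t := fun h => hsw hvtX ((hp _ _).2 h)
  have upu : u ≠ p u := (hpG u).ne
  have vpv : v ≠ p v := (hpG v).ne
  have tpt : t ≠ p t := (hpG t).ne
  have pinj : ∀ x y, p x = p y → x = y := fun x y h => by rw [← hpp x, h, hpp]
  have puv : p u ≠ p v := fun h => uv (pinj _ _ h)
  have put : p u ≠ p t := fun h => ut (pinj _ _ h)
  have pvt : p v ≠ p t := fun h => vt (pinj _ _ h)
  have cov := hcov u v t uv.symm vpu ut.symm tpu vt.symm tpv
  have au1 : ¬ G.Adj u (p v) := fun h => by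
    rcases nu _ h with h | h | h
    · exact vpv h.symm
    · exact tpv h.symm
    · exact puv h.symm
  have au2 : ¬ G.Adj u (p t) := fun h => by
    rcases nu _ h with h | h | h
    · exact vpt h.symm
    · exact tpt h.symm
    · exact put h.symm
  have av1 : ¬ G.Adj v (p u) := fun h => by
    rcases nv _ h with h | h | h
    · exact upu h.symm
    · exact tpu h.symm
    · exact puv h
  have av2 : ¬ G.Adj v (p t) := fun h => by
    rcases nv _ h with h | h | h
    · exact upt h.symm
    · exact tpt h.symm
    · exact pvt h.symm
  have at1 : ¬ G.Adj t (p u) := fun h => by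
    rcases nt _ h with h | h | h
    · exact upu h.symm
    · exact vpu h.symm
    · exact put h
  have at2 : ¬ G.Adj t (p v) := fun h => by
    rcases nt _ h with h | h | h
    · exact upv h.symm
    · exact vpv h.symm
    · exact pvt h
  -- the other triangle
  have other : ∀ x y z, (∀ w, w = x ∨ w = y ∨ w = z ∨ w = p x ∨ w = p y ∨ w = p z) →
      ¬ G.Adj y (p x) → ¬ G.Adj z (p x) → (∃ w, G.Adj (p x) w ∧ s(p x, w) ∉ X) →
      G.Adj (p x) (p y) ∧ G.Adj (p x) (p z) := by
    intro x y z hcv h1 h2 ⟨w, hw, hwX⟩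
    obtain ⟨b, hb, hbX⟩ := hN _ w hw hwX
    obtain ⟨b1, b2, b3, b4, b5, b6⟩ := hb
    have cand : ∀ a, G.Adj (p x) a → a ≠ p (p x) → a = p y ∨ a = p z := by
      intro a ha hne
      rw [hpp] at hne
      rcases hcv a with h | h | h | h | h | h
      · exact absurd h hne
      · exact absurd (h ▸ ha.symm) h1
      · exact absurd (h ▸ ha.symm) h2
      · exact absurd h ha.ne.symm
      · exact Or.inl h
      · exact Or.inr h
    rcases cand w hw b2.symm with h | h <;> rcases cand b b5 b1.symm with h' | h'
    · exact absurd (h'.trans h.symm) b3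
    · exact ⟨h ▸ hw, h' ▸ b5⟩
    · exact ⟨h' ▸ b5, h ▸ hw⟩
    · exact absurd (h'.trans h.symm) b3
  have deg : ∀ x, (∃ w, G.Adj x w ∧ s(x, w) ∉ X) := by
    intro x
    by_contra hcon
    push Not at hcon
    have hdeg := deg_three G (by omega) hG x
    have hsub : G.neighborSet x ⊆ {p x} := fun z hz => (hp _ _).1 (hcon z hz)
    have := Set.ncard_le_ncard hsub (Set.toFinite _)
    rw [Set.ncard_singleton] at this
    omega
  obtain ⟨q1, q2⟩ := other u v t cov av1 at1 (deg _)
  obtain ⟨_, q3⟩ := other v u t (fun w => by have := cov w; tauto) au1 at2 (deg _)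
  refine ⟨![u, v, t, p u, p v, p t], ⟨?_, ?_⟩, ?_, ?_⟩
  · intro i j hij
    fin_cases i <;> fin_cases j <;> simp at hij ⊢ <;> grind
  · intro w
    rcases cov w with h | h | h | h | h | h
    · exact ⟨0, h.symm⟩
    · exact ⟨1, h.symm⟩
    · exact ⟨2, h.symm⟩
    · exact ⟨3, h.symm⟩
    · exact ⟨4, h.symm⟩
    · exact ⟨5, h.symm⟩
  · have s1 : ¬ G.Adj (p v) u := fun h => au1 h.symm
    have s2 : ¬ G.Adj (p t) u := fun h => au2 h.symm
    have s3 : ¬ G.Adj (p u) v := fun h => av1 h.symm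
    have s4 : ¬ G.Adj (p t) v := fun h => av2 h.symm
    have s5 : ¬ G.Adj (p u) t := fun h => at1 h.symm
    have s6 : ¬ G.Adj (p v) t := fun h => at2 h.symm
    intro i j
    fin_cases i <;> fin_cases j <;>
      simp [prismGraph, huv, huv.symm, htu, htu.symm, htv, htv.symm, hpG, (hpG _).symm, q1, q2, q3,
        q1.symm, q2.symm, q3.symm, au1, au2, av1, av2, at1, at2, s1, s2, s3, s4, s5, s6]
  · ext e
    induction e using Sym2.ind with
    | _ x y =>
      rw [hp]
      simp only [weirdPrism, Set.image_insert_eq, Set.image_singleton, Sym2.map_mk]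
      simp
      constructor
      · rintro rfl
        rcases cov x with rfl | rfl | rfl | rfl | rfl | rfl <;> simp [hpp]
      · rintro ((⟨rfl, rfl⟩ | ⟨rfl, rfl⟩) | (⟨rfl, rfl⟩ | ⟨rfl, rfl⟩) | (⟨rfl, rfl⟩ | ⟨rfl, rfl⟩)) <;>
          simp [hpp]

end

end TCW
/-- **Lemma (situation3).** If `(G, X)` is 3-connected, not constraint connected, and every edge
not in `X` is essential, then `G[X]` has precisely two components or `(G, X)` is the weird
prism. -/
theorem two_components_or_weird_prism (C : CGraph) (hWF : C.WF) (h3 : KConnected 3 C.G)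
    (hnc : ¬ EdgeSetConnected C.X)
    (hess : ∀ e ∈ C.G.edgeSet, e ∉ C.X → Essential C e) :
    edgeComponents C.X = 2 ∨ CGIso C weirdPrism := by
  by_cases h2 : edgeComponents C.X = 2
  · exact Or.inl h2
  right
  have hX := TCW.NC_three hnc h2
  obtain ⟨hc, hG⟩ := (TCW.kconn_iff _).1 h3
  have hdeg := TCW.deg_three C.G hc hG
  have h6 := TCW.card_of_NC hX
  have hall := TCW.all_nonX C hWF h3 hX hess
  have hst : ∀ u v, C.G.Adj u v → s(u, v) ∉ C.X → _ := fun u v hadj hx =>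
    TCW.step1 C hWF h3 hX hadj hx (hess _ hadj hx)
  have hpex : ∀ u, ∃ p, s(u, p) ∈ C.X ∧ ∀ y, s(u, y) ∈ C.X → y = p := by
    intro u
    obtain ⟨v, hv, hvX⟩ := hall u
    obtain ⟨a, b, hab, h1, h2, _⟩ := hst u v hv hvX
    refine ⟨a, h1, fun y hy => ?_⟩
    rcases hab.2.2.2.2.2 y (hWF hy) with rfl | rfl | rfl
    · exact absurd hy hvX
    · rfl
    · exact absurd hy h2
  choose p hp1 hp2 using hpex
  have hp : ∀ x y, s(x, y) ∈ C.X ↔ y = p x :=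
    fun x y => ⟨hp2 x y, fun h => h ▸ hp1 x⟩
  have hpG : ∀ x, C.G.Adj x (p x) := fun x => hWF (hp1 x)
  have hsupp : ∀ x, x ∈ (fromEdgeSet C.X).support := fun x =>
    (TCW.mem_supp _ _).2 ⟨p x, hp1 x, (hpG x).ne⟩
  have hpp : ∀ x, p (p x) = x := by
    intro x
    have h1 := hp1 x
    rw [Sym2.eq_swap] at h1
    exact ((hp _ _).1 h1).symm
  have hreach : ∀ x y, (fromEdgeSet C.X).Reachable x y → y = x ∨ y = p x := by
    intro x y hr
    refine TCW.reach_closed (fun z => z = x ∨ z = p x) ?_ hr (Or.inl rfl)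
    rintro a b hab ha
    have hb : b = p a := (hp _ _).1 ((fromEdgeSet_adj _).1 hab).1
    rcases ha with rfl | rfl
    · exact Or.inr hb
    · exact Or.inl (hb.trans (hpp _))
  obtain ⟨u0, v0, h0, h0X⟩ := TCW.exists_nonX C.G C.X h3 hX
  have h4 : ¬ TCW.NC C.X 4 := by
    obtain ⟨_, _, _, _, _, _, h4⟩ := hst u0 v0 h0 h0X
    exact h4
  have hcov : ∀ x y z, y ≠ x → y ≠ p x → z ≠ x → z ≠ p x → z ≠ y → z ≠ p y →
      ∀ w, w = x ∨ w = y ∨ w = z ∨ w = p x ∨ w = p y ∨ w = p z := by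
    intro x y z a1 a2 a3 a4 a5 a6 w
    by_contra hcon
    push Not at hcon
    obtain ⟨c1, c2, c3, c4, c5, c6⟩ := hcon
    apply h4
    have r1 : ¬ (fromEdgeSet C.X).Reachable x y := fun h => (hreach _ _ h).elim a1 a2
    have r2 : ¬ (fromEdgeSet C.X).Reachable x z := fun h => (hreach _ _ h).elim a3 a4
    have r3 : ¬ (fromEdgeSet C.X).Reachable y z := fun h => (hreach _ _ h).elim a5 a6
    have r4 : ¬ (fromEdgeSet C.X).Reachable x w := fun h => (hreach _ _ h).elim c1 c4
    have r5 : ¬ (fromEdgeSet C.X).Reachable y w := fun h => (hreach _ _ h).elim c2 c5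
    have r6 : ¬ (fromEdgeSet C.X).Reachable z w := fun h => (hreach _ _ h).elim c3 c6
    have sy : ∀ {a b}, ¬ (fromEdgeSet C.X).Reachable a b → ¬ (fromEdgeSet C.X).Reachable b a :=
      fun h h' => h h'.symm
    refine ⟨![x, y, z, w], fun i => hsupp _, ?_⟩
    intro i j hij
    fin_cases i <;> fin_cases j <;> first
      | exact absurd rfl hij
      | assumption
      | exact sy r1
      | exact sy r2
      | exact sy r3
      | exact sy r4
      | exact sy r5
      | exact sy r6
  have hcard : Nat.card C.V ≤ 6 := by
    obtain ⟨g, _, hg⟩ := hX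
    have hpr : ∀ x, (fromEdgeSet C.X).Reachable x (p x) := fun x =>
      Adj.reachable ((fromEdgeSet_adj _).2 ⟨hp1 x, (hpG x).ne⟩)
    have hgn : ∀ i j, i ≠ j → g j ≠ g i ∧ g j ≠ p (g i) := fun i j hij =>
      ⟨fun h => hg i j hij (h ▸ Reachable.refl _), fun h => hg i j hij (h ▸ hpr _)⟩
    have cov := hcov (g 0) (g 1) (g 2) (hgn 0 1 (by decide)).1 (hgn 0 1 (by decide)).2
      (hgn 0 2 (by decide)).1 (hgn 0 2 (by decide)).2 (hgn 1 2 (by decide)).1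
      (hgn 1 2 (by decide)).2
    have hsur : Function.Surjective (![g 0, g 1, g 2, p (g 0), p (g 1), p (g 2)] : Fin 6 → C.V) := by
      intro w
      rcases cov w with h | h | h | h | h | h
      · exact ⟨0, h.symm⟩
      · exact ⟨1, h.symm⟩
      · exact ⟨2, h.symm⟩
      · exact ⟨3, h.symm⟩
      · exact ⟨4, h.symm⟩
      · exact ⟨5, h.symm⟩
    have := Nat.card_le_card_of_surjective _ hsur
    simpa using this
  obtain ⟨f, hf, hfG, hfX⟩ := TCW.finish C.G C.X p hG h6 hp hpG (by
      intro u v hadj hx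
      obtain ⟨a, b, hab, h1, h2, _⟩ := hst u v hadj hx
      rw [(hp _ _).1 h1] at hab
      exact ⟨b, hab, h2⟩) (by
      intro u v hadj hx
      obtain ⟨P', Q', hs⟩ := TCW.noncontr C h3 hX hadj (hess _ hadj hx)
      exact TCW.tri C.G hcard hG hdeg hadj.ne hs) hcov ⟨u0, v0, h0, h0X⟩
  let ψ : prismGraph ≃g C.G :=
    { toEquiv := Equiv.ofBijective f hf
      map_rel_iff' := by
        intro i j
        exact (hfG i j).symm }
  refine ⟨ψ.symm, ?_⟩
  have hψ : ∀ i, ψ.symm (f i) = i := fun i => ψ.symm_apply_apply i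
  rw [hfX]
  have : ∀ e : Sym2 (Fin 6), Sym2.map (⇑ψ.symm) (Sym2.map f e) = e := by
    intro e
    induction e using Sym2.ind with
    | _ x y => simp only [Sym2.map_mk, hψ]
  ext e
  constructor
  · rintro ⟨_, ⟨e', he', rfl⟩, rfl⟩
    have h := this e'
    exact (congrArg (· ∈ weirdPrism.X) h).mpr he'
  · intro he
    exact ⟨_, ⟨e, he, rfl⟩, this e⟩
end

section
/- Let (G,X) be a 3-connected constraint graph such that the subgraph G[X] has at least three connected components. Assume (G,X) is not the constraint Wagner graph, not the weird prism, and not the Wagner prism. Then there is a 3-connected constraint minor (G',X') of (G,X) such that X' is disconnected in G' and E(G')∖X' is a proper subset of E(G)∖X. -/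
open SimpleGraph

namespace COr

/-- `P` and `Q` are nonempty disjoint sets with no edges between them. -/
def Sp {V : Type*} (G : SimpleGraph V) (P Q : Set V) : Prop :=
  P.Nonempty ∧ Q.Nonempty ∧ Disjoint P Q ∧ ∀ p ∈ P, ∀ q ∈ Q, ¬ G.Adj p q

theorem Sp.symm {V : Type*} {G : SimpleGraph V} {P Q : Set V} (h : Sp G P Q) : Sp G Q P :=
  ⟨h.2.1, h.1, h.2.2.1.symm, fun q hq p hp hadj => h.2.2.2 p hp q hq hadj.symm⟩

theorem kconn_iff {V : Type*} [Finite V] (G : SimpleGraph V) :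
    KConnected 3 G ↔ 3 < Nat.card V ∧ ∀ P Q, Sp G P Q → 3 ≤ ((P ∪ Q)ᶜ).ncard := by
  unfold KConnected
  refine and_congr_right fun hc => ⟨?_, ?_⟩
  · rintro h P Q ⟨⟨p, hp⟩, ⟨q, hq⟩, hd, hn⟩
    by_contra hlt
    have hconn := h _ (not_le.mp hlt)
    have hp' : p ∈ ((P ∪ Q)ᶜ)ᶜ := by simp [hp]
    have hq' : q ∈ ((P ∪ Q)ᶜ)ᶜ := by simp [hq]
    obtain ⟨W⟩ := hconn.preconnected ⟨p, hp'⟩ ⟨q, hq'⟩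
    have key : ∀ (x y : ((P ∪ Q)ᶜᶜ : Set V)), (G.induce ((P ∪ Q)ᶜᶜ)).Walk x y →
        x.1 ∈ P → y.1 ∈ P := by
      intro x y W
      induction W with
      | nil => exact id
      | cons hadj _ ih =>
        rename_i a b c _
        intro ha
        apply ih
        have hb : b.1 ∈ P ∪ Q := not_not.mp b.2
        rcases hb with hb | hb
        · exact hb
        · exact absurd hadj (hn _ ha _ hb)
    exact Set.disjoint_left.mp hd (key _ _ W hp) hq
  · intro h S hS
    have hne : Sᶜ.Nonempty := by
      rw [Set.nonempty_compl]
      rintro rfl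
      rw [Set.ncard_univ] at hS
      omega
    have : Nonempty (Sᶜ : Set V) := hne.to_subtype
    refine SimpleGraph.Connected.mk ?_
    intro x y
    by_contra hxy
    let P : Set V := {z | ∃ hz : z ∈ Sᶜ, (G.induce Sᶜ).Reachable x ⟨z, hz⟩}
    let Q : Set V := {z | ∃ hz : z ∈ Sᶜ, ¬ (G.induce Sᶜ).Reachable x ⟨z, hz⟩}
    have hsp : Sp G P Q := by
      refine ⟨⟨x, x.2, Reachable.refl _⟩, ⟨y, y.2, hxy⟩, ?_, ?_⟩
      · rw [Set.disjoint_left]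
        rintro z ⟨_, h1⟩ ⟨_, h2⟩
        exact h2 h1
      · rintro p ⟨hp, h1⟩ q ⟨hq, h2⟩ hadj
        refine h2 (h1.trans (SimpleGraph.Adj.reachable ?_))
        exact hadj
    have h3 := h P Q hsp
    have : (P ∪ Q)ᶜ = S := by
      ext z
      simp only [P, Q, Set.mem_compl_iff, Set.mem_union, Set.mem_ofPred_eq]
      by_cases hz : z ∈ S
      · simp [hz]
      · by_cases hr : (G.induce Sᶜ).Reachable x ⟨z, hz⟩ <;> simp [hz, hr]
    rw [this] at h3
    omega

/-- No two vertices separate a nonempty set from something. -/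
theorem sep2 {V : Type*} [Finite V] {G : SimpleGraph V}
    (h3 : ∀ P Q, Sp G P Q → 3 ≤ ((P ∪ Q)ᶜ).ncard) (R : Set V) (r1 r2 t : V)
    (ht : t ∉ R) (ht1 : t ≠ r1) (ht2 : t ≠ r2) (hr1 : r1 ∉ R) (hr2 : r2 ∉ R)
    (hN : ∀ p ∈ R, ∀ z, G.Adj p z → z ∈ R ∨ z = r1 ∨ z = r2) : ∀ p, p ∉ R := by
  intro p hp
  have := h3 R {z | z ∉ R ∧ z ≠ r1 ∧ z ≠ r2} ⟨⟨p, hp⟩, ⟨t, ht, ht1, ht2⟩, by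
    rw [Set.disjoint_left]; grind, by
    intro p hp q hq hadj
    have := hN p hp q hadj
    simp only [Set.mem_ofPred_eq] at hq
    grind⟩
  have hle : ((R ∪ {z | z ∉ R ∧ z ≠ r1 ∧ z ≠ r2})ᶜ).ncard ≤ ({r1, r2} : Set V).ncard := by
    apply Set.ncard_le_ncard _ (Set.toFinite _)
    intro z hz
    simp only [Set.mem_compl_iff, Set.mem_union, Set.mem_ofPred_eq] at hz
    simp only [Set.mem_insert_iff, Set.mem_singleton_iff]
    grind
  have := Set.ncard_insert_le r1 {r2}
  rw [Set.ncard_singleton] at this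
  omega

def Small {V : Type*} (G : SimpleGraph V) (t : V) : Prop :=
  ∃ x y, ∀ z, G.Adj t z → z = x ∨ z = y

theorem del_adj {V : Type*} (G : SimpleGraph V) (u v a b : V) :
    (G.deleteEdges {s(u, v)}).Adj a b ↔ G.Adj a b ∧ ¬ ((a = u ∧ b = v) ∨ (a = v ∧ b = u)) := by
  simp [SimpleGraph.deleteEdges_adj]

section bixby
variable {V : Type*} [Finite V] {G : SimpleGraph V}

theorem bix1 (h3 : ∀ P Q, Sp G P Q → 3 ≤ ((P ∪ Q)ᶜ).ncard) {u v w : V} {A B P Q : Set V}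
    (hA : A.Nonempty)
    (hAB : ∀ p ∈ A, ∀ q ∈ B, ¬ G.Adj p q) (huA : u ∉ A) (hvA : v ∉ A) (hwA : w ∉ A)
    (hT : ∀ z, z ∈ A ∨ z ∈ B ∨ z = u ∨ z = v ∨ z = w)
    (hwv : w ≠ v) (hwu : w ≠ u)
    (hPQ : ∀ p ∈ P, ∀ q ∈ Q, G.Adj p q → (p = u ∧ q = v))
    (hd : Disjoint P Q) (hu : u ∈ P) (hv : v ∈ Q) : ∃ a ∈ A, a ∉ P ∧ a ∉ Q := by
  by_contra hcon
  push Not at hcon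
  have hd' := Set.disjoint_left.mp hd
  have h1 := sep2 h3 (A ∩ P) u w v (by grind) (by grind) (by grind) (by grind) (by grind) (by
    intro p hp z hz
    have := hPQ p hp.2 z
    have := hAB p hp.1 z
    have := hT z
    have := hcon z
    grind)
  have h2 := sep2 h3 (A ∩ Q) v w u (by grind) (by grind) (by grind) (by grind) (by grind) (by
    intro p hp z hz
    have := hPQ z 
    have := hAB p hp.1 z
    have := hT z
    have := hcon z
    have := hz.symm
    grind)
  obtain ⟨a, ha⟩ := hA
  have := h1 a
  have := h2 a
  grind

theorem bix2 (h3 : ∀ P Q, Sp G P Q → 3 ≤ ((P ∪ Q)ᶜ).ncard) {u v w a b : V} {A B P Q : Set V}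
    (hAB : ∀ p ∈ A, ∀ q ∈ B, ¬ G.Adj p q) (hdAB : Disjoint A B)
    (huA : u ∉ A) (hvA : v ∉ A) 
    (huB : u ∉ B) (hvB : v ∉ B) 
    (hT : ∀ z, z ∈ A ∨ z ∈ B ∨ z = u ∨ z = v ∨ z = w)
    (hPQ : ∀ p ∈ P, ∀ q ∈ Q, G.Adj p q → (p = u ∧ q = v))
    (hd : Disjoint P Q) (hu : u ∈ P) (hv : v ∈ Q) (hw : w ∈ Q)
    (ha : a ∈ A) (hb : b ∈ B) (haP : a ∉ P) (haQ : a ∉ Q) (hbP : b ∉ P) (hbQ : b ∉ Q)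
    (hS : ∀ z, z ∈ P ∨ z ∈ Q ∨ z = a ∨ z = b) :
    P ⊆ {u} ∧ ∀ z, G.Adj u z → z = v ∨ z = a ∨ z = b := by
  have hd' := Set.disjoint_left.mp hd
  have hdAB' := Set.disjoint_left.mp hdAB
  have h1 := sep2 h3 (P ∩ A) u a v (by grind) (by grind) (by grind) (by grind) (by grind) (by
    intro p hp z hz
    have := hPQ p hp.1 z
    have := hAB p hp.2 z
    have := hT z
    have := hS z
    grind)
  have h2 := sep2 h3 (P ∩ B) u b v (by grind) (by grind) (by grind) (by grind) (by grind) (by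
    intro p hp z hz
    have := hPQ p hp.1 z
    have := fun h => hAB z h p hp.2 hz.symm
    have := hT z
    have := hS z
    grind)
  have hP : P ⊆ {u} := by
    intro z hz
    have := h1 z
    have := h2 z
    have := hT z
    simp only [Set.mem_singleton_iff]
    grind
  refine ⟨hP, fun z hz => ?_⟩
  have := hS z
  have := hPQ u hu z
  have : z ∈ P → z = u := fun h => hP h
  have := hz.ne
  grind

theorem bix3 (h3 : ∀ P Q, Sp G P Q → 3 ≤ ((P ∪ Q)ᶜ).ncard) {u v : V} (huv : G.Adj u v)
    {A B : Set V} (hAB : Sp G A B) (huA : u ∉ A ∪ B) (hvA : v ∉ A ∪ B)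
    (hc : ((A ∪ B)ᶜ).ncard ≤ 3) {P Q : Set V}
    (hPQ : Sp (G.deleteEdges {s(u, v)}) P Q) (hS : ((P ∪ Q)ᶜ).ncard ≤ 2)
    (hu : u ∈ P) (hv : v ∈ Q) :
    P ⊆ {t | (t = u ∨ t = v) ∧ Small (G.deleteEdges {s(u, v)}) t} ∨
    Q ⊆ {t | (t = u ∨ t = v) ∧ Small (G.deleteEdges {s(u, v)}) t} := by
  have hne := huv.ne
  have hc3 : ((A ∪ B)ᶜ).ncard = 3 := le_antisymm hc (h3 A B hAB)
  obtain ⟨w, hw⟩ : ∃ w, (A ∪ B)ᶜ = {u, v, w} ∧ w ≠ u ∧ w ≠ v := by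
    have hsub : ({u, v} : Set V) ⊆ (A ∪ B)ᶜ := by
      intro z hz
      rcases hz with rfl | rfl
      · exact huA
      · exact hvA
    have h1 : ((A ∪ B)ᶜ \ {u, v}).ncard = 1 := by
      have := Set.ncard_sdiff_add_ncard_of_subset hsub (Set.toFinite _)
      rw [Set.ncard_pair hne] at this
      omega
    obtain ⟨w, hw⟩ := Set.ncard_eq_one.mp h1
    have hwm : w ∈ (A ∪ B)ᶜ \ {u, v} := by rw [hw]; rfl
    refine ⟨w, ?_, by grind, by grind⟩
    rw [← Set.sdiff_union_of_subset hsub, hw]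
    ext z; simp only [Set.mem_union, Set.mem_insert_iff, Set.mem_singleton_iff]; tauto
  obtain ⟨hw, hwu, hwv⟩ := hw
  have hmem : ∀ z, (z ∉ A ∧ z ∉ B) ↔ (z = u ∨ z = v ∨ z = w) := by
    intro z
    have : z ∈ (A ∪ B)ᶜ ↔ z ∈ ({u, v, w} : Set V) := by rw [hw]
    simpa using this
  have hT : ∀ z, z ∈ A ∨ z ∈ B ∨ z = u ∨ z = v ∨ z = w := by
    intro z; have := hmem z; tauto
  have hT' : ∀ z, z ∈ B ∨ z ∈ A ∨ z = u ∨ z = v ∨ z = w := by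
    intro z; have := hmem z; tauto
  have hu' := (hmem u).2 (by simp)
  have hv' := (hmem v).2 (by simp)
  have hw' := (hmem w).2 (by simp)
  obtain ⟨hAne, hBne, hABd, hABn⟩ := hAB
  have hBAn : ∀ p ∈ B, ∀ q ∈ A, ¬ G.Adj p q := fun p hp q hq h => hABn q hq p hp h.symm
  obtain ⟨hPne, hQne, hPQd, hPQn⟩ := hPQ
  have hd' := Set.disjoint_left.mp hPQd
  have hPQ' : ∀ p ∈ P, ∀ q ∈ Q, G.Adj p q → (p = u ∧ q = v) := by
    intro p hp q hq hadj
    have := hPQn p hp q hq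
    rw [del_adj] at this
    have := hd' hu
    grind
  obtain ⟨a, ha, haP, haQ⟩ := bix1 h3 hAne hABn hu'.1 hv'.1 hw'.1 hT hwv hwu hPQ' hPQd hu hv
  obtain ⟨b, hb, hbP, hbQ⟩ := bix1 h3 hBne hBAn hu'.2 hv'.2 hw'.2 hT' hwv hwu hPQ' hPQd hu hv
  have hab : a ≠ b := by
    rintro rfl
    exact Set.disjoint_left.mp hABd ha hb
  have hSeq : ({a, b} : Set V) = (P ∪ Q)ᶜ := by
    apply Set.eq_of_subset_of_ncard_le _ _ (Set.toFinite _)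
    · rintro z (rfl | rfl) <;> simp_all
    · rw [Set.ncard_pair hab]; exact hS
  have hSz : ∀ z, z ∈ P ∨ z ∈ Q ∨ z = a ∨ z = b := by
    intro z
    have : z ∈ (P ∪ Q)ᶜ ↔ z ∈ ({a, b} : Set V) := by rw [hSeq]
    simp only [Set.mem_compl_iff, Set.mem_union, Set.mem_insert_iff, Set.mem_singleton_iff] at this
    tauto
  have hwPQ : w ∈ P ∨ w ∈ Q := by
    have := hSz w
    grind
  rcases hwPQ with hwP | hwQ
  · right
    obtain ⟨h1, h2⟩ := bix2 (u := v) (v := u) (P := Q) (Q := P) h3 hABn hABd hv'.1 hu'.1 hv'.2 hu'.2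
      (fun z => by have := hT z; tauto) (fun p hp q hq h => (hPQ' q hq p hp h.symm).symm)
      hPQd.symm hv hu hwP ha hb haQ haP hbQ hbP (fun z => by have := hSz z; tauto)
    intro z hz
    have hz := h1 hz
    rw [Set.mem_singleton_iff] at hz
    subst hz
    refine ⟨Or.inr rfl, a, b, fun y hy => ?_⟩
    rw [del_adj] at hy
    have := h2 y hy.1
    tauto
  · left
    obtain ⟨h1, h2⟩ := bix2 (u := u) (v := v) (P := P) (Q := Q) h3 hABn hABd hu'.1 hv'.1 hu'.2 hv'.2
      hT hPQ' hPQd hu hv hwQ ha hb haP haQ hbP hbQ hSz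
    intro z hz
    have hz := h1 hz
    rw [Set.mem_singleton_iff] at hz
    subst hz
    refine ⟨Or.inl rfl, a, b, fun y hy => ?_⟩
    rw [del_adj] at hy
    have := h2 y hy.1
    tauto

/-- Every separation of order at most two is trivial: one side lies in `D`. -/
def KD (H : SimpleGraph V) (D : Set V) : Prop :=
  ∀ P Q, Sp H P Q → ((P ∪ Q)ᶜ).ncard ≤ 2 → P ⊆ D ∨ Q ⊆ D

theorem bixby (h3 : ∀ P Q, Sp G P Q → 3 ≤ ((P ∪ Q)ᶜ).ncard) {u v : V} (huv : G.Adj u v)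
    {A B : Set V} (hAB : Sp G A B) (huA : u ∉ A ∪ B) (hvA : v ∉ A ∪ B)
    (hc : ((A ∪ B)ᶜ).ncard ≤ 3) :
    KD (G.deleteEdges {s(u, v)}) {t | (t = u ∨ t = v) ∧ Small (G.deleteEdges {s(u, v)}) t} := by
  intro P Q hPQ hS
  by_cases h1 : u ∈ P ∧ v ∈ Q
  · exact bix3 h3 huv hAB huA hvA hc hPQ hS h1.1 h1.2
  by_cases h2 : u ∈ Q ∧ v ∈ P
  · exact (bix3 h3 huv hAB huA hvA hc hPQ.symm (by rwa [Set.union_comm]) h2.1 h2.2).symm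
  exfalso
  have := h3 P Q ⟨hPQ.1, hPQ.2.1, hPQ.2.2.1, fun p hp q hq hadj => by
    have := hPQ.2.2.2 p hp q hq
    rw [del_adj] at this
    grind⟩
  omega

end bixby

section contraction
variable {V : Type*}

theorem cf_self {u v : V} (huv : u ≠ v) : contractFun huv v = ⟨u, huv⟩ := by
  simp [contractFun]

theorem cf_ne {u v : V} (huv : u ≠ v) {x : V} (hx : x ≠ v) : contractFun huv x = ⟨x, hx⟩ := by
  simp [contractFun, hx]

theorem cf_val {u v : V} (huv : u ≠ v) (x : {w : V // w ≠ v}) : contractFun huv x.1 = x :=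
  cf_ne huv x.2

theorem cg_adj {G : SimpleGraph V} {u v : V} (huv : u ≠ v) (a b : {w : V // w ≠ v}) :
    (contractGraph G huv).Adj a b ↔
      a ≠ b ∧ ∃ x y, G.Adj x y ∧ contractFun huv x = a ∧ contractFun huv y = b := by
  unfold contractGraph
  rw [fromEdgeSet_adj, and_comm]
  refine and_congr_right fun _ => ?_
  constructor
  · rintro ⟨e, he, h⟩
    induction e with
    | h x y =>
      rw [Sym2.map_mk, Sym2.eq_iff] at h
      rw [mem_edgeSet] at he
      rcases h with ⟨h1, h2⟩ | ⟨h1, h2⟩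
      · exact ⟨x, y, he, h1, h2⟩
      · exact ⟨y, x, he.symm, h2, h1⟩
  · rintro ⟨x, y, h, rfl, rfl⟩
    exact ⟨s(x, y), h, rfl⟩

theorem sp_pre {G : SimpleGraph V} {u v : V} (huv : u ≠ v) {P Q : Set {w : V // w ≠ v}}
    (h : Sp (contractGraph G huv) P Q) :
    Sp G (contractFun huv ⁻¹' P) (contractFun huv ⁻¹' Q) := by
  obtain ⟨⟨p, hp⟩, ⟨q, hq⟩, hd, hn⟩ := h
  refine ⟨⟨p.1, by simpa [cf_val] using hp⟩, ⟨q.1, by simpa [cf_val] using hq⟩,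
    hd.preimage _, ?_⟩
  intro x hx y hy hadj
  refine hn _ hx _ hy ((cg_adj huv _ _).2 ⟨?_, x, y, hadj, rfl, rfl⟩)
  intro h
  exact Set.disjoint_left.mp hd hx (by rw [h]; exact hy)

theorem card_sub [Finite V] (v : V) : Nat.card {w : V // w ≠ v} + 1 = Nat.card V := by
  classical
  have := Fintype.ofFinite V
  have h := Fintype.card_subtype_compl (fun w : V => w = v)
  rw [Nat.card_eq_fintype_card, Nat.card_eq_fintype_card]
  have h2 : Fintype.card {w : V // w = v} = 1 := Fintype.card_subtype_eq v
  have : 0 < Fintype.card V := Fintype.card_pos_iff.mpr ⟨v⟩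
  have h3 : Fintype.card {w : V // w ≠ v} = Fintype.card {w : V // ¬ w = v} := rfl
  omega

/-- If contracting an edge destroys 3-connectivity then its ends lie in a 3-separator. -/
theorem contract_bad [Finite V] {G : SimpleGraph V} (hcard : 5 ≤ Nat.card V)
    (h3 : ∀ P Q, Sp G P Q → 3 ≤ ((P ∪ Q)ᶜ).ncard) {u v : V} (huv : u ≠ v)
    (hbad : ¬ KConnected 3 (contractGraph G huv)) :
    ∃ A B, Sp G A B ∧ u ∉ A ∪ B ∧ v ∉ A ∪ B ∧ ((A ∪ B)ᶜ).ncard ≤ 3 := by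
  rw [kconn_iff] at hbad
  push Not at hbad
  obtain ⟨P, Q, hPQ, hlt⟩ := hbad (by have := card_sub v; omega)
  have hsp := sp_pre huv hPQ
  refine ⟨_, _, hsp, ?_⟩
  have himg : (((↑) : {w : V // w ≠ v} → V) '' (P ∪ Q)ᶜ).ncard ≤ 2 := by
    have := Set.ncard_image_le (f := ((↑) : {w : V // w ≠ v} → V)) (Set.toFinite (P ∪ Q)ᶜ)
    omega
  have hu : (⟨u, huv⟩ : {w : V // w ≠ v}) ∉ P ∪ Q := by
    intro hmem
    have h := h3 _ _ hsp
    have hsub : (contractFun huv ⁻¹' P ∪ contractFun huv ⁻¹' Q)ᶜ ⊆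
        ((↑) : {w : V // w ≠ v} → V) '' (P ∪ Q)ᶜ := by
      intro z hz
      by_cases hzv : z = v
      · subst hzv
        exfalso
        apply hz
        simpa [cf_self] using hmem
      · exact ⟨⟨z, hzv⟩, by simpa [cf_ne huv hzv] using hz, rfl⟩
    have := Set.ncard_le_ncard hsub (Set.toFinite _)
    omega
  refine ⟨by simpa [cf_ne huv huv] using hu, by simpa [cf_self] using hu, ?_⟩
  have hsub : (contractFun huv ⁻¹' P ∪ contractFun huv ⁻¹' Q)ᶜ ⊆
        insert v (((↑) : {w : V // w ≠ v} → V) '' (P ∪ Q)ᶜ) := by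
      intro z hz
      by_cases hzv : z = v
      · exact Or.inl hzv
      · exact Or.inr ⟨⟨z, hzv⟩, by simpa [cf_ne huv hzv] using hz, rfl⟩
  have := Set.ncard_le_ncard hsub (Set.toFinite _)
  have := Set.ncard_insert_le v (((↑) : {w : V // w ≠ v} → V) '' (P ∪ Q)ᶜ)
  omega

/-- Suppressing a vertex `u` with at most two neighbours `x`, `y`. -/
theorem kd_suppress [Finite V] {H : SimpleGraph V} {D : Set V} (hK : KD H D) {x u : V}
    (hxu : x ≠ u) (y : V) (hN : ∀ z, H.Adj u z → z = x ∨ z = y) :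
    KD (contractGraph H hxu) {t | t.1 ∈ D} := by
  intro P Q hPQ hlt
  have himg : (((↑) : {w : V // w ≠ u} → V) '' (P ∪ Q)ᶜ).ncard ≤ 2 := by
    have := Set.ncard_image_le (f := ((↑) : {w : V // w ≠ u} → V)) (Set.toFinite (P ∪ Q)ᶜ)
    omega
  have hsp := sp_pre hxu hPQ
  by_cases hx : (⟨x, hxu⟩ : {w : V // w ≠ u}) ∈ P ∪ Q
  · have hsub : (contractFun hxu ⁻¹' P ∪ contractFun hxu ⁻¹' Q)ᶜ ⊆
        ((↑) : {w : V // w ≠ u} → V) '' (P ∪ Q)ᶜ := by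
      intro z hz
      by_cases hzv : z = u
      · subst hzv
        exfalso
        apply hz
        simpa [cf_self] using hx
      · exact ⟨⟨z, hzv⟩, by simpa [cf_ne hxu hzv] using hz, rfl⟩
    have h1 := Set.ncard_le_ncard hsub (Set.toFinite _)
    rcases hK _ _ hsp (by omega) with h | h
    · left
      intro t ht
      exact h (by simpa [cf_val] using ht)
    · right
      intro t ht
      exact h (by simpa [cf_val] using ht)
  · -- `x` lies in the separator: put `u` on the side of `y`
    have hxP : (⟨x, hxu⟩ : {w : V // w ≠ u}) ∉ P := fun h => hx (Or.inl h)
    have hxQ : (⟨x, hxu⟩ : {w : V // w ≠ u}) ∉ Q := fun h => hx (Or.inr h)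
    have aux : ∀ P Q : Set {w : V // w ≠ u}, Sp H (contractFun hxu ⁻¹' P) (contractFun hxu ⁻¹' Q) →
        (((↑) : {w : V // w ≠ u} → V) '' (P ∪ Q)ᶜ).ncard ≤ 2 →
        (⟨x, hxu⟩ : {w : V // w ≠ u}) ∉ P → (⟨x, hxu⟩ : {w : V // w ≠ u}) ∉ Q →
        y ∉ contractFun hxu ⁻¹' Q → P ⊆ {t | t.1 ∈ D} ∨ Q ⊆ {t | t.1 ∈ D} := by
      intro P Q hsp himg hxP hxQ hy
      have huQ : u ∉ contractFun hxu ⁻¹' Q := by simpa [cf_self] using hxQ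
      have hsp' : Sp H (insert u (contractFun hxu ⁻¹' P)) (contractFun hxu ⁻¹' Q) := by
        refine ⟨⟨u, Or.inl rfl⟩, hsp.2.1, ?_, ?_⟩
        · rw [Set.disjoint_insert_left]
          exact ⟨huQ, hsp.2.2.1⟩
        · rintro p (rfl | hp) q hq hadj
          · rcases hN q hadj with rfl | rfl
            · apply hxQ
              simpa [cf_ne hxu hxu] using hq
            · exact hy hq
          · exact hsp.2.2.2 p hp q hq hadj
      have hsub : (insert u (contractFun hxu ⁻¹' P) ∪ contractFun hxu ⁻¹' Q)ᶜ ⊆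
          ((↑) : {w : V // w ≠ u} → V) '' (P ∪ Q)ᶜ := by
        intro z hz
        have hzv : z ≠ u := by
          rintro rfl
          exact hz (Or.inl (Or.inl rfl))
        refine ⟨⟨z, hzv⟩, ?_, rfl⟩
        intro h
        apply hz
        rcases h with h | h
        · exact Or.inl (Or.inr (by simpa [cf_ne hxu hzv] using h))
        · exact Or.inr (by simpa [cf_ne hxu hzv] using h)
      have h1 := Set.ncard_le_ncard hsub (Set.toFinite _)
      rcases hK _ _ hsp' (by omega) with h | h
      · left
        intro t ht
        exact h (Or.inr (by simpa [cf_val] using ht))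
      · right
        intro t ht
        exact h (by simpa [cf_val] using ht)
    by_cases hy : y ∈ contractFun hxu ⁻¹' Q
    · refine (aux Q P hsp.symm (by rwa [Set.union_comm]) hxQ hxP ?_).symm
      exact fun h => Set.disjoint_left.mp hsp.2.2.1 h hy
    · exact aux P Q hsp himg hxP hxQ hy

theorem kd_empty [Finite V] {H : SimpleGraph V} {D : Set V} (hK : KD H D) (hD : ∀ t, t ∉ D)
    (hc : 3 < Nat.card V) : KConnected 3 H := by
  rw [kconn_iff]
  refine ⟨hc, fun P Q hPQ => ?_⟩
  by_contra hlt
  rcases hK P Q hPQ (by omega) with h | h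
  · obtain ⟨p, hp⟩ := hPQ.1
    exact hD p (h hp)
  · obtain ⟨p, hp⟩ := hPQ.2.1
    exact hD p (h hp)

/-- A colouring with `n` colours witnessing that `X` has at least `n` components. -/
def IsCol (n : ℕ) (X : Set (Sym2 V)) (c : V → Fin n) : Prop :=
  (∀ a b, s(a, b) ∈ X → c a = c b) ∧ ∀ i, ∃ a b, a ≠ b ∧ s(a, b) ∈ X ∧ c a = i

def Col (n : ℕ) (X : Set (Sym2 V)) : Prop := ∃ c : V → Fin n, IsCol n X c

/-- The contracted constraint. -/
def cX (X : Set (Sym2 V)) {u v : V} (huv : u ≠ v) : Set (Sym2 {w : V // w ≠ v}) :=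
  {e | e ∈ Sym2.map (contractFun huv) '' X ∧ ¬ e.IsDiag}

theorem mem_cX {X : Set (Sym2 V)} {u v : V} (huv : u ≠ v) {a b : V} (h : s(a, b) ∈ X)
    (hne : contractFun huv a ≠ contractFun huv b) :
    s(contractFun huv a, contractFun huv b) ∈ cX X huv :=
  ⟨⟨s(a, b), h, rfl⟩, by simpa using hne⟩

theorem of_mem_cX {X : Set (Sym2 V)} {u v : V} (huv : u ≠ v) {a b : {w : V // w ≠ v}}
    (h : s(a, b) ∈ cX X huv) :
    ∃ x y, s(x, y) ∈ X ∧ contractFun huv x = a ∧ contractFun huv y = b := by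
  obtain ⟨⟨e, he, h⟩, -⟩ := h
  induction e with
  | h x y =>
    rw [Sym2.map_mk, Sym2.eq_iff] at h
    rcases h with ⟨h1, h2⟩ | ⟨h1, h2⟩
    · exact ⟨x, y, he, h1, h2⟩
    · exact ⟨y, x, by rwa [Sym2.eq_swap], h2, h1⟩

theorem col_lossless {n : ℕ} {X : Set (Sym2 V)} {c : V → Fin n} {x u : V} (hxu : x ≠ u)
    (hmono : ∀ a b, s(a, b) ∈ X → c a = c b)
    (hcx : c x = c u)
    (hcol : ∀ i, ∃ a b, a ≠ b ∧ s(a, b) ∈ X ∧ c a = i ∧ s(a, b) ≠ s(x, u)) :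
    Col n (cX X hxu) := by
  have hf : ∀ z, c (contractFun hxu z).1 = c z := by
    intro z
    by_cases hz : z = u
    · subst hz; rw [cf_self, hcx]
    · rw [cf_ne hxu hz]
  refine ⟨fun z => c z.1, ?_, ?_⟩
  · intro a b hab
    obtain ⟨p, q, hpq, rfl, rfl⟩ := of_mem_cX hxu hab
    simp only [hf]
    exact hmono _ _ hpq
  · intro i
    obtain ⟨a, b, hne, hab, hc, hn⟩ := hcol i
    have hne' : contractFun hxu a ≠ contractFun hxu b := by
      intro h
      by_cases ha : a = u
      · subst ha
        rw [cf_self, cf_ne hxu hne.symm, Subtype.mk.injEq] at h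
        subst h
        exact hn Sym2.eq_swap
      · by_cases hb : b = u
        · subst hb
          rw [cf_self, cf_ne hxu hne, Subtype.mk.injEq] at h
          subst h
          exact hn rfl
        · rw [cf_ne hxu ha, cf_ne hxu hb, Subtype.mk.injEq] at h
          exact hne h
    exact ⟨_, _, hne', mem_cX hxu hab hne', by simp only [hf]; exact hc⟩

theorem exists_merge {n : ℕ} (p q : Fin (n + 2)) :
    ∃ g : Fin (n + 2) → Fin (n + 1), g p = g q ∧ ∀ j, ∃ i, i ≠ q ∧ g i = j := by
  classical
  let g0 : Fin (n + 2) → Fin (n + 1) := Function.invFun q.succAbove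
  refine ⟨Function.update g0 q (g0 p), ?_, fun j => ⟨q.succAbove j, Fin.succAbove_ne q j, ?_⟩⟩
  · by_cases h : p = q
    · rw [h]
    · rw [Function.update_of_ne h, Function.update_self]
  · rw [Function.update_of_ne (Fin.succAbove_ne q j)]
    exact Function.leftInverse_invFun Fin.succAbove_right_injective j

theorem col_drop {n : ℕ} {X : Set (Sym2 V)} (h : Col (n + 2) X) {x u : V} (hxu : x ≠ u) :
    Col (n + 1) (cX X hxu) := by
  obtain ⟨c, hmono, hcol⟩ := h
  obtain ⟨g, hg1, hg2⟩ := exists_merge (c x) (c u)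
  refine col_lossless (c := fun z => g (c z)) hxu (fun a b hab => ?_) hg1 (fun i => ?_)
  · simp only [hmono a b hab]
  · obtain ⟨j, hj, rfl⟩ := hg2 i
    obtain ⟨a, b, hne, hab, rfl⟩ := hcol j
    refine ⟨a, b, hne, hab, rfl, fun h => ?_⟩
    rw [Sym2.eq_iff] at h
    have := hmono a b hab
    rcases h with ⟨rfl, rfl⟩ | ⟨rfl, rfl⟩
    · exact hj this
    · exact hj rfl

theorem col_disc {n : ℕ} {X : Set (Sym2 V)} (h : Col (n + 2) X) : ¬ EdgeSetConnected X := by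
  obtain ⟨c, hmono, hcol⟩ := h
  intro hconn
  obtain ⟨a, b, hab, hX, ha⟩ := hcol 0
  obtain ⟨p, q, hpq, hX', hp⟩ := hcol 1
  have h1 : a ∈ (fromEdgeSet X).support :=
    ⟨b, (fromEdgeSet_adj X).2 ⟨hX, hab⟩⟩
  have h2 : p ∈ (fromEdgeSet X).support :=
    ⟨q, (fromEdgeSet_adj X).2 ⟨hX', hpq⟩⟩
  obtain ⟨W⟩ := hconn a h1 p h2
  have key : ∀ x y, (fromEdgeSet X).Walk x y → c x = c y := by
    intro x y W
    induction W with
    | nil => rfl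
    | cons hadj _ ih =>
      rw [fromEdgeSet_adj] at hadj
      rw [hmono _ _ hadj.1, ih]
  have := key a p W
  rw [ha, hp] at this
  exact absurd this (by simp)

theorem col_of_comp {X : Set (Sym2 V)} (h : 3 ≤ edgeComponents X) : Col 3 X := by
  classical
  unfold edgeComponents at h
  have hfin : Finite (edgeSubgraph X).ConnectedComponent :=
    (Nat.card_pos_iff.mp (by omega)).2
  have := Fintype.ofFinite (edgeSubgraph X).ConnectedComponent
  rw [Nat.card_eq_fintype_card] at h
  obtain ⟨ι⟩ : Nonempty (Fin 3 ↪ (edgeSubgraph X).ConnectedComponent) :=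
    Function.Embedding.nonempty_of_card_le (by simpa using h)
  let g : (edgeSubgraph X).ConnectedComponent → Fin 3 := Function.invFun ι
  have hg : ∀ i, g (ι i) = i := Function.leftInverse_invFun ι.injective
  refine ⟨fun a => if ha : a ∈ (fromEdgeSet X).support then
    g ((edgeSubgraph X).connectedComponentMk ⟨a, ha⟩) else 0, ?_, ?_⟩
  · intro a b hab
    by_cases hne : a = b
    · rw [hne]
    have hadj : (fromEdgeSet X).Adj a b := by rw [fromEdgeSet_adj]; exact ⟨hab, hne⟩
    have ha : a ∈ (fromEdgeSet X).support := ⟨b, hadj⟩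
    have hb : b ∈ (fromEdgeSet X).support := ⟨a, hadj.symm⟩
    simp only [ha, hb, dif_pos]
    congr 1
    apply ConnectedComponent.sound
    apply SimpleGraph.Adj.reachable
    exact hadj
  · intro i
    obtain ⟨⟨a, ha⟩, hai⟩ := (ι i).exists_rep
    obtain ⟨b, hb⟩ := ha
    have hb' := (fromEdgeSet_adj X).1 hb
    refine ⟨a, b, hb'.2, hb'.1, ?_⟩
    have ha : a ∈ (fromEdgeSet X).support := ⟨b, hb⟩
    simp only [ha, dif_pos]
    have : (edgeSubgraph X).connectedComponentMk ⟨a, ha⟩ = ι i := hai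
    rw [this, hg]

end contraction

section minors

noncomputable def nX (C : CGraph) : ℕ := (C.G.edgeSet \ C.X).ncard

def Goal (C : CGraph) : Prop :=
  ∃ C', IsCMinor C C' ∧ KConnected 3 C'.G ∧ ¬ EdgeSetConnected C'.X ∧ nX C' < nX C

theorem contract_sub (C : CGraph) (u v : C.V) (huv : u ≠ v) :
    (C.contract u v huv).G.edgeSet \ (C.contract u v huv).X ⊆
      Sym2.map (contractFun huv) '' ((C.G.edgeSet \ C.X) \ {s(u, v)}) := by
  rintro e ⟨he, hx⟩
  have hE : e ∈ (fromEdgeSet (Sym2.map (contractFun huv) '' C.G.edgeSet)).edgeSet := he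
  rw [edgeSet_fromEdgeSet] at hE
  obtain ⟨⟨e', he', rfl⟩, hd⟩ := hE
  have hd' : ¬ (Sym2.map (contractFun huv) e').IsDiag := hd
  refine ⟨e', ⟨⟨he', fun h => hx ⟨⟨e', h, rfl⟩, hd'⟩⟩, ?_⟩, rfl⟩
  rintro rfl
  apply hd'
  rw [Sym2.map_mk, cf_self, cf_ne huv huv]
  simp

theorem contract_le (C : CGraph) (u v : C.V) (huv : u ≠ v) :
    nX (C.contract u v huv) ≤ nX C := by
  unfold nX
  refine (Set.ncard_le_ncard (contract_sub C u v huv) (Set.toFinite _)).trans ?_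
  refine (Set.ncard_image_le (Set.toFinite _)).trans ?_
  exact Set.ncard_le_ncard Set.sdiff_subset (Set.toFinite _)

theorem contract_lt (C : CGraph) {u v : C.V} (huv : C.G.Adj u v) (hx : s(u, v) ∉ C.X) :
    nX (C.contract u v huv.ne) < nX C := by
  unfold nX
  refine (Set.ncard_le_ncard (contract_sub C u v huv.ne) (Set.toFinite _)).trans_lt ?_
  refine (Set.ncard_image_le (Set.toFinite _)).trans_lt ?_
  exact Set.ncard_sdiff_singleton_lt_of_mem ⟨huv, hx⟩ (Set.toFinite _)

theorem delete_lt (C : CGraph) {u v : C.V} (huv : C.G.Adj u v) (hx : s(u, v) ∉ C.X) :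
    nX (C.deleteEdge s(u, v)) < nX C := by
  unfold nX
  apply Set.ncard_lt_ncard _ (Set.toFinite _)
  refine ⟨?_, ?_⟩
  · rintro e ⟨he, h⟩
    have he' : e ∈ (C.G.deleteEdges {s(u, v)}).edgeSet := he
    rw [edgeSet_deleteEdges] at he'
    exact ⟨he'.1, h⟩
  · intro h
    have h1 : s(u, v) ∈ (C.G.deleteEdges {s(u, v)}).edgeSet := (h ⟨huv, hx⟩).1
    rw [edgeSet_deleteEdges] at h1
    exact h1.2 rfl

theorem finish1 (C H : CGraph) (hm : IsCMinor C H) (hlt : nX H < nX C) (v : H.V) {D : Set H.V}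
    (hK : KD H.G D) (hD : ∀ t ∈ D, t = v ∧ Small H.G t) (hcol : Col 3 H.X)
    (hcard : 5 ≤ Nat.card H.V) (hnb : ∃ x, H.G.Adj v x) : Goal C := by
  by_cases hs : Small H.G v
  · obtain ⟨p, q, hpq⟩ := hs
    obtain ⟨x, hx⟩ := hnb
    obtain ⟨y, hy⟩ : ∃ y, ∀ z, H.G.Adj v z → z = x ∨ z = y := by
      rcases hpq x hx with rfl | rfl
      · exact ⟨q, hpq⟩
      · exact ⟨p, fun z hz => (hpq z hz).symm⟩
    have hxv : x ≠ v := hx.ne'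
    refine ⟨H.contract x v hxv, hm.tail (CMinorStep.contr H x v hx.symm), ?_, ?_, ?_⟩
    · have hK' := kd_suppress hK hxv y hy
      refine kd_empty hK' (fun t ht => ?_) ?_
      · exact t.2 (hD _ ht).1
      · have := card_sub v
        change 3 < Nat.card {w // w ≠ v}
        omega
    · exact col_disc (n := 0) (col_drop (n := 1) hcol hxv)
    · exact (contract_le H x v hxv).trans_lt hlt
  · refine ⟨H, hm, kd_empty hK (fun t ht => ?_) (by omega), col_disc (n := 1) hcol, hlt⟩
    obtain ⟨rfl, h⟩ := hD t ht
    exact hs h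

theorem deg3 {V : Type*} [Finite V] {G : SimpleGraph V}
    (h3 : ∀ P Q, Sp G P Q → 3 ≤ ((P ∪ Q)ᶜ).ncard) (hcard : 6 ≤ Nat.card V) (u a b : V) :
    ∃ z, G.Adj u z ∧ z ≠ a ∧ z ≠ b := by
  by_contra hcon
  push Not at hcon
  have hQ : ({u, a, b} : Set V)ᶜ.Nonempty := by
    rw [Set.nonempty_compl]
    intro h
    have h1 : ({u, a, b} : Set V).ncard ≤ 3 := by
      have := Set.ncard_insert_le u {a, b}
      have := Set.ncard_insert_le a {b}
      rw [Set.ncard_singleton] at this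
      omega
    rw [h, Set.ncard_univ] at h1
    omega
  have h := h3 {u} ({u, a, b} : Set V)ᶜ ⟨⟨u, rfl⟩, hQ, by
    rw [Set.disjoint_left]; simp, by
    intro p hp q hq hadj
    rw [Set.mem_singleton_iff] at hp
    subst hp
    have := hcon q hadj
    simp only [Set.mem_compl_iff, Set.mem_insert_iff, Set.mem_singleton_iff] at hq
    grind⟩
  have hle : (({u} ∪ ({u, a, b} : Set V)ᶜ)ᶜ).ncard ≤ ({a, b} : Set V).ncard := by
    apply Set.ncard_le_ncard _ (Set.toFinite _)
    intro z hz
    simp only [Set.mem_compl_iff, Set.mem_union, Set.mem_insert_iff, Set.mem_singleton_iff] at hz ⊢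
    grind
  have := Set.ncard_insert_le a {b}
  rw [Set.ncard_singleton] at this
  omega

theorem not_contr (C : CGraph) (hG : ¬ Goal C) (hcol : Col 3 C.X) {u v : C.V}
    (huv : C.G.Adj u v) (hx : s(u, v) ∉ C.X) : ¬ KConnected 3 (contractGraph C.G huv.ne) := by
  intro h
  exact hG ⟨C.contract u v huv.ne, Relation.ReflTransGen.single (CMinorStep.contr C u v huv), h,
    col_disc (n := 0) (col_drop (n := 1) hcol huv.ne), contract_lt C huv hx⟩

theorem main_step (C : CGraph) (h3 : ∀ P Q, Sp C.G P Q → 3 ≤ ((P ∪ Q)ᶜ).ncard)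
    (hcard : 6 ≤ Nat.card C.V) (hG : ¬ Goal C) (hcol : Col 3 C.X) {u v : C.V}
    (huv : C.G.Adj u v) (hx : s(u, v) ∉ C.X) :
    Small (C.G.deleteEdges {s(u, v)}) u ∧
    ∀ x, C.G.Adj u x → x ≠ v → ∀ hxu : x ≠ u, ¬ Col 3 (cX C.X hxu) := by
  obtain ⟨A, B, hAB, huA, hvA, hc⟩ := contract_bad (by omega) h3 huv.ne
    (not_contr C hG hcol huv hx)
  have hK := bixby h3 huv hAB huA hvA hc
  have hstep : IsCMinor C (C.deleteEdge s(u, v)) :=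
    Relation.ReflTransGen.single (CMinorStep.del C s(u, v) huv hx)
  have hlt := delete_lt C huv hx
  obtain ⟨q, hq, hqu, -⟩ := deg3 h3 hcard v u u
  have hsm : Small (C.G.deleteEdges {s(u, v)}) u := by
    by_contra hs
    refine hG (finish1 C (C.deleteEdge s(u, v)) hstep hlt v hK ?_ hcol
      (show 5 ≤ Nat.card C.V by omega) ⟨q, (del_adj C.G u v v q).2 ⟨hq, ?_⟩⟩)
    · rintro t ⟨ht, h⟩
      rcases ht with ht | ht
      · rw [ht] at h
        exact absurd h hs
      · exact ⟨ht, h⟩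
    · have := huv.ne
      grind
  refine ⟨hsm, fun x hux hxv hxu hcol' => hG ?_⟩
  have hHux : (C.G.deleteEdges {s(u, v)}).Adj u x := (del_adj C.G u v u x).2 ⟨hux, by
    have := huv.ne
    grind⟩
  obtain ⟨y, hy⟩ : ∃ y, ∀ z, (C.G.deleteEdges {s(u, v)}).Adj u z → z = x ∨ z = y := by
    obtain ⟨p, q, hpq⟩ := hsm
    rcases hpq x hHux with rfl | rfl
    · exact ⟨q, hpq⟩
    · exact ⟨p, fun z hz => (hpq z hz).symm⟩
  have hK' := kd_suppress hK hxu y hy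
  have hvu : v ≠ u := huv.ne'
  refine finish1 C ((C.deleteEdge s(u, v)).contract x u hxu)
    (hstep.tail (CMinorStep.contr (C.deleteEdge s(u, v)) x u hHux.symm))
    ((contract_le (C.deleteEdge s(u, v)) x u hxu).trans_lt hlt) ⟨v, hvu⟩ hK' ?_ hcol' ?_ ?_
  · rintro t ⟨ht, p, r, hpr⟩
    have ht' : t.1 = v := by
      rcases ht with h | h
      · exact absurd h t.2
      · exact h
    refine ⟨Subtype.ext ht', contractFun hxu p, contractFun hxu r, fun z hz => ?_⟩
    obtain ⟨-, i, j, hij, hi, rfl⟩ := (cg_adj hxu t z).1 hz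
    have hit : i = t.1 := by
      by_cases hiu : i = u
      · subst hiu
        rw [cf_self] at hi
        rw [← hi] at ht'
        exact absurd ht' hxv
      · rw [cf_ne hxu hiu] at hi
        rw [← hi]
    subst hit
    rcases hpr j hij with rfl | rfl
    · exact Or.inl rfl
    · exact Or.inr rfl
  · have := card_sub u
    change 5 ≤ Nat.card {w // w ≠ u}
    omega
  · refine ⟨⟨q, hqu⟩, (cg_adj hxu _ _).2 ⟨?_, v, q, (del_adj C.G u v v q).2 ⟨hq, ?_⟩,
      cf_ne hxu hvu, cf_ne hxu hqu⟩⟩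
    · intro h
      exact hq.ne (congrArg Subtype.val h)
    · grind

/-- Structure at the ends of edges outside the constraint. -/
theorem main_fact (C : CGraph) (hWF : C.WF) (h3 : ∀ P Q, Sp C.G P Q → 3 ≤ ((P ∪ Q)ᶜ).ncard)
    (hcard : 6 ≤ Nat.card C.V) (hG : ¬ Goal C) (hcol : Col 3 C.X) {u v : C.V}
    (huv : C.G.Adj u v) (hx : s(u, v) ∉ C.X) :
    Small (C.G.deleteEdges {s(u, v)}) u ∧
    ∃ w, s(u, w) ∈ C.X ∧ (∀ z, s(u, z) ∈ C.X → z = w) ∧ ∀ z, s(w, z) ∈ C.X → z = u := by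
  classical
  obtain ⟨hsm, hno⟩ := main_step C h3 hcard hG hcol huv hx
  refine ⟨hsm, ?_⟩
  obtain ⟨c, hmono, hc⟩ := hcol
  have hex : ∃ w, s(u, w) ∈ C.X := by
    by_contra hcon
    push Not at hcon
    obtain ⟨x, hux, hxv, -⟩ := deg3 h3 hcard u v v
    have hne : ∀ a b, s(a, b) ∈ C.X → a ≠ u ∧ b ≠ u := by
      intro a b hab
      refine ⟨?_, ?_⟩
      · rintro rfl
        exact hcon _ hab
      · rintro rfl
        rw [Sym2.eq_swap] at hab
        exact hcon _ hab
    refine hno x hux hxv hux.ne' (col_lossless (c := Function.update c u (c x)) _ ?_ ?_ ?_)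
    · intro a b hab
      obtain ⟨h1, h2⟩ := hne a b hab
      rw [Function.update_of_ne h1, Function.update_of_ne h2]
      exact hmono a b hab
    · rw [Function.update_of_ne hux.ne', Function.update_self]
    · intro i
      obtain ⟨a, b, hab, hX, hi⟩ := hc i
      obtain ⟨h1, h2⟩ := hne a b hX
      refine ⟨a, b, hab, hX, by rw [Function.update_of_ne h1]; exact hi, fun h => ?_⟩
      rw [Sym2.eq_iff] at h
      tauto
  obtain ⟨w, hw⟩ := hex
  have huw : C.G.Adj u w := hWF hw
  have hwv : w ≠ v := by rintro rfl; exact hx hw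
  have huniq : ∀ p q, s(p, q) ∈ C.X → c p = c u → s(p, q) = s(w, u) := by
    by_contra hcon
    push Not at hcon
    obtain ⟨p, q, hpq, hcp, hn⟩ := hcon
    refine hno w huw hwv huw.ne' (col_lossless (c := c) _ hmono (hmono _ _ hw).symm ?_)
    intro i
    by_cases hi : i = c u
    · refine ⟨p, q, ?_, hpq, by rw [hi, hcp], hn⟩
      exact (show C.G.Adj p q from hWF hpq).ne
    · obtain ⟨a, b, hab, hX, hi'⟩ := hc i
      refine ⟨a, b, hab, hX, hi', fun h => hi ?_⟩
      have := hmono u w hw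
      rw [Sym2.eq_iff] at h
      rcases h with ⟨rfl, rfl⟩ | ⟨rfl, rfl⟩
      · rw [← hi', this]
      · rw [← hi']
  refine ⟨w, hw, fun z hz => ?_, fun z hz => ?_⟩
  · have := huniq u z hz rfl
    rw [Sym2.eq_iff] at this
    have := huw.ne
    grind
  · have := huniq w z hz (hmono _ _ hw).symm
    rw [Sym2.eq_iff] at this
    have := huw.ne
    grind

end minors

section endgame

theorem mkIso (C D : CGraph) (p : D.V → C.V) (hp : Function.Bijective p)
    (hadj : ∀ i j, C.G.Adj (p i) (p j) ↔ D.G.Adj i j)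
    (hX : ∀ i j, s(p i, p j) ∈ C.X ↔ s(i, j) ∈ D.X) : CGIso C D := by
  let e : D.V ≃ C.V := Equiv.ofBijective p hp
  have he : ∀ i, e i = p i := fun i => rfl
  refine ⟨⟨e.symm, ?_⟩, ?_⟩
  · intro a b
    rw [← hadj, ← he, ← he, e.apply_symm_apply, e.apply_symm_apply]
  · ext f
    constructor
    · rintro ⟨g, hg, rfl⟩
      induction g with
      | h a b =>
        change s(e.symm a, e.symm b) ∈ D.X
        rw [← hX, ← he, ← he, e.apply_symm_apply, e.apply_symm_apply]
        exact hg
    · intro hf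
      induction f with
      | h i j =>
        refine ⟨s(p i, p j), (hX i j).2 hf, ?_⟩
        change s(e.symm (p i), e.symm (p j)) = s(i, j)
        rw [← he, ← he, e.symm_apply_apply, e.symm_apply_apply]

theorem prismIso (C : CGraph) (Y : Set (Sym2 (Fin 6))) (m : C.V → C.V)
    (hm : ∀ x y, s(x, y) ∈ C.X ↔ y = m x) (p : Fin 6 → C.V) (hp : Function.Bijective p)
    (h0 : ∀ z, C.G.Adj (p 0) z ↔ z = p 1 ∨ z = p 2 ∨ z = p 3)
    (h1 : ∀ z, C.G.Adj (p 1) z ↔ z = p 0 ∨ z = p 2 ∨ z = p 4)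
    (h2 : ∀ z, C.G.Adj (p 2) z ↔ z = p 0 ∨ z = p 1 ∨ z = p 5)
    (h3 : ∀ z, C.G.Adj (p 3) z ↔ z = p 4 ∨ z = p 5 ∨ z = p 0)
    (h4 : ∀ z, C.G.Adj (p 4) z ↔ z = p 3 ∨ z = p 5 ∨ z = p 1)
    (h5 : ∀ z, C.G.Adj (p 5) z ↔ z = p 3 ∨ z = p 4 ∨ z = p 2)
    (σ : Fin 6 → Fin 6) (hσ : ∀ i, m (p i) = p (σ i)) (hY : ∀ i j, s(i, j) ∈ Y ↔ j = σ i) :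
    CGIso C (CGraph.mk (Fin 6) prismGraph Y) := by
  have hinj := hp.1
  have key : ∀ i j : Fin 6, C.G.Adj (p i) (p j) ↔ prismGraph.Adj i j := by
    intro i j
    fin_cases i <;> simp [h0, h1, h2, h3, h4, h5, hinj.eq_iff, prismGraph] <;> clear * - <;>
      revert j <;> decide
  refine mkIso C _ p hp key ?_
  · intro i j
    change s(p i, p j) ∈ C.X ↔ s(i, j) ∈ Y
    rw [hm, hσ, hp.1.eq_iff, hY]

theorem six_cover {V : Type*} [Finite V] (hcard : Nat.card V = 6) (p : Fin 6 → V)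
    (hp : Function.Injective p) : Function.Bijective p := by
  have := Fintype.ofFinite V
  rw [Nat.card_eq_fintype_card] at hcard
  exact (Fintype.bijective_iff_injective_and_card p).2 ⟨hp, by simp [hcard]⟩

theorem inj6 {V : Type*} {a b c d e f : V} (h : [a, b, c, d, e, f].Nodup) :
    Function.Injective ![a, b, c, d, e, f] := by
  have := List.nodup_iff_injective_get.1 h
  intro i j hij
  apply this
  fin_cases i <;> fin_cases j <;> exact hij

theorem wagnerX (i j : Fin 6) :
    s(i, j) ∈ ({s(0, 3), s(1, 2), s(4, 5)} : Set (Sym2 (Fin 6))) ↔ j = ![3, 2, 1, 0, 5, 4] i := by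
  simp only [Set.mem_insert_iff, Set.mem_singleton_iff, Sym2.eq_iff]
  revert i j
  decide

theorem weirdX (i j : Fin 6) :
    s(i, j) ∈ ({s(0, 3), s(1, 4), s(2, 5)} : Set (Sym2 (Fin 6))) ↔ j = ![3, 4, 5, 0, 1, 2] i := by
  simp only [Set.mem_insert_iff, Set.mem_singleton_iff, Sym2.eq_iff]
  revert i j
  decide

set_option maxHeartbeats 2000000 in
theorem prism_end (C : CGraph) (m : C.V → C.V) (hcard : Nat.card C.V = 6)
    (hm : ∀ x y, s(x, y) ∈ C.X ↔ y = m x)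
    (hP : ¬ CGIso C weirdPrism) (hWP : ¬ CGIso C wagnerPrism)
    (hWF : C.WF) {a u v w b c : C.V}
    (hnd : [a, u, v, w, b, c].Nodup)
    (ha : ∀ z, C.G.Adj a z ↔ z = u ∨ z = v ∨ z = w)
    (hu : ∀ z, C.G.Adj u z ↔ z = a ∨ z = v ∨ z = b)
    (hv : ∀ z, C.G.Adj v z ↔ z = a ∨ z = u ∨ z = c)
    (hw : ∀ z, C.G.Adj w z ↔ z = b ∨ z = c ∨ z = a)
    (hb : ∀ z, C.G.Adj b z ↔ z = w ∨ z = c ∨ z = u)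
    (hc : ∀ z, C.G.Adj c z ↔ z = w ∨ z = b ∨ z = v) (huv : m u ≠ v) : False := by
  have hadj : ∀ x, C.G.Adj x (m x) := fun x => hWF ((hm x (m x)).2 rfl)
  have hmm : ∀ x, m (m x) = x := fun x => by
    have := (hm x (m x)).2 rfl
    rw [Sym2.eq_swap, hm] at this
    exact this.symm
  have ka := (ha _).1 (hadj a)
  have ku := (hu _).1 (hadj u)
  have kv := (hv _).1 (hadj v)
  have kw := (hw _).1 (hadj w)
  have kb := (hb _).1 (hadj b)
  have kc := (hc _).1 (hadj c)
  have ma := hmm a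
  have mu := hmm u
  have mv := hmm v
  have mw := hmm w
  have mb := hmm b
  have mc := hmm c
  have hnd' := hnd
  simp only [List.nodup_cons, List.mem_cons, List.not_mem_nil, or_false, not_or,
    not_false_eq_true, List.nodup_nil, and_true] at hnd'
  by_cases h1 : m u = a
  · have e1 : m a = u := by grind
    have e2 : m v = c := by grind
    have e3 : m c = v := by grind
    have e4 : m w = b := by grind
    have e5 : m b = w := by grind
    refine hWP (prismIso C _ m hm ![v, a, u, c, w, b]
      (six_cover hcard _ (inj6 (by
        clear * - hnd
        grind)))
      hv (fun z => (ha z).trans or_left_comm) (fun z => (hu z).trans or_left_comm)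
      hc (fun z => (hw z).trans or_left_comm) (fun z => (hb z).trans or_left_comm)
      ![3, 2, 1, 0, 5, 4] ?_ wagnerX)
    intro i
    fin_cases i <;> simp [e1, e2, e3, e4, e5, h1]
  · have h2 : m u = b := by grind
    by_cases h3 : m v = a
    · have e1 : m a = v := by grind
      have e2 : m b = u := by grind
      have e3 : m c = w := by grind
      have e4 : m w = c := by grind
      refine hWP (prismIso C _ m hm ![u, a, v, b, w, c]
        (six_cover hcard _ (inj6 (by
        clear * - hnd
        grind)))
        hu ha (fun z => (hv z).trans or_left_comm) hb hw (fun z => (hc z).trans or_left_comm)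
        ![3, 2, 1, 0, 5, 4] ?_ wagnerX)
      intro i
      fin_cases i <;> simp [e1, e2, e3, e4, h2, h3]
    · have e1 : m v = c := by grind
      have e2 : m b = u := by grind
      have e3 : m c = v := by grind
      have e4 : m w = a := by grind
      have e5 : m a = w := by grind
      refine hP (prismIso C _ m hm ![a, u, v, w, b, c]
        (six_cover hcard _ (inj6 hnd))
        ha hu hv hw hb hc
        ![3, 4, 5, 0, 1, 2] ?_ weirdX)
      intro i
      fin_cases i <;> simp [e1, e2, e3, e4, e5, h2]

theorem tri_end (C : CGraph) (m : C.V → C.V) (hcard : Nat.card C.V = 6)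
    (h3 : ∀ P Q, Sp C.G P Q → 3 ≤ ((P ∪ Q)ᶜ).ncard)
    (hm : ∀ x y, s(x, y) ∈ C.X ↔ y = m x)
    (hP : ¬ CGIso C weirdPrism) (hWP : ¬ CGIso C wagnerPrism)
    (hWF : C.WF)
    (hdeg : ∀ x, ∃ p q r, ∀ z, C.G.Adj x z → z = p ∨ z = q ∨ z = r)
    {a u v : C.V} (hau : C.G.Adj a u) (hav : C.G.Adj a v) (huv : C.G.Adj u v)
    (hmu : m u ≠ v) : False := by
  have hN : ∀ x p q, p ≠ q → C.G.Adj x p → C.G.Adj x q →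
      ∃ r, r ≠ p ∧ r ≠ q ∧ ∀ z, C.G.Adj x z ↔ z = p ∨ z = q ∨ z = r := by
    intro x p q hpq hp hq
    obtain ⟨r, hr, hrp, hrq⟩ := deg3 h3 (by omega) x p q
    refine ⟨r, hrp, hrq, fun z => ⟨fun hz => ?_, ?_⟩⟩
    · obtain ⟨p', q', r', h⟩ := hdeg x
      have := h z hz
      have := h p hp
      have := h q hq
      have := h r hr
      grind
    · rintro (rfl | rfl | rfl) <;> assumption
  obtain ⟨w, hwu, hwv, ha⟩ := hN a u v huv.ne hau hav
  obtain ⟨b, hba, hbv, hu⟩ := hN u a v hav.ne hau.symm huv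
  obtain ⟨c, hca, hcu, hv⟩ := hN v a u hau.ne hav.symm huv.symm
  have haw : C.G.Adj a w := (ha w).2 (by simp)
  have hub : C.G.Adj u b := (hu b).2 (by simp)
  have hvc : C.G.Adj v c := (hv c).2 (by simp)
  have n1 := hau.ne
  have n2 := hav.ne
  have n3 := huv.ne
  have n4 := haw.ne
  have n5 := hub.ne
  have n6 := hvc.ne
  have hsep : ∀ r1 r2, r1 ≠ a → r1 ≠ u → r1 ≠ v → r2 ≠ a → r2 ≠ u → r2 ≠ v →
      (w = r1 ∨ w = r2) → (b = r1 ∨ b = r2) → (c = r1 ∨ c = r2) → False := by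
    intro r1 r2 h1 h2 h3' h4 h5 h6 hw hb hc
    have hQ : ({a, u, v, r1, r2} : Set C.V)ᶜ.Nonempty := by
      rw [Set.nonempty_compl]
      intro h
      have h1 : ({a, u, v, r1, r2} : Set C.V).ncard ≤ 5 := by
        have := Set.ncard_insert_le a {u, v, r1, r2}
        have := Set.ncard_insert_le u {v, r1, r2}
        have := Set.ncard_insert_le v {r1, r2}
        have := Set.ncard_insert_le r1 {r2}
        rw [Set.ncard_singleton] at this
        omega
      rw [h, Set.ncard_univ] at h1
      omega
    obtain ⟨t, ht⟩ := hQ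
    simp only [Set.mem_compl_iff, Set.mem_insert_iff, Set.mem_singleton_iff, not_or] at ht
    refine sep2 h3 {a, u, v} r1 r2 t ?_ ht.2.2.2.1 ht.2.2.2.2 ?_ ?_ ?_ a (by simp)
    · simp [ht]
    · simp [h1, h2, h3']
    · simp [h4, h5, h6]
    · intro p hp z hz
      simp only [Set.mem_insert_iff, Set.mem_singleton_iff] at hp ⊢
      rcases hp with rfl | rfl | rfl
      · have := (ha z).1 hz
        grind
      · have := (hu z).1 hz
        grind
      · have := (hv z).1 hz
        grind
  have hbc : b ≠ c := by
    intro h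
    exact hsep w b n4.symm hwu hwv hba n5.symm hbv (by simp) (by simp) (by simp [h])
  have hbw : b ≠ w := by
    intro h
    exact hsep w c n4.symm hwu hwv hca hcu n6.symm (by simp) (by simp [h]) (by simp)
  have hcw : c ≠ w := by
    intro h
    exact hsep w b n4.symm hwu hwv hba n5.symm hbv (by simp) (by simp) (by simp [h])
  have hnd : [a, u, v, w, b, c].Nodup := by
    simp only [List.nodup_cons, List.mem_cons, List.not_mem_nil, or_false, not_or,
      not_false_eq_true, List.nodup_nil, and_true]
    grind
  have hcov : ∀ z, z = a ∨ z = u ∨ z = v ∨ z = w ∨ z = b ∨ z = c := by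
    intro z
    obtain ⟨i, rfl⟩ := (six_cover hcard _ (inj6 hnd)).2 z
    fin_cases i <;> simp
  have key : ∀ x p q r, (∀ z, C.G.Adj x z → z = p ∨ z = q ∨ z = r) →
      ∀ z, C.G.Adj x z ↔ z = p ∨ z = q ∨ z = r := by
    intro x p q r h z
    refine ⟨h z, ?_⟩
    obtain ⟨z1, hz1, h11, h12⟩ := deg3 h3 (by omega) x p q
    obtain ⟨z2, hz2, h21, h22⟩ := deg3 h3 (by omega) x p r
    obtain ⟨z3, hz3, h31, h32⟩ := deg3 h3 (by omega) x q r
    have := h z1 hz1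
    have := h z2 hz2
    have := h z3 hz3
    grind
  have hua := fun z (h : C.G.Adj z u) => (hu z).1 h.symm
  have hva := fun z (h : C.G.Adj z v) => (hv z).1 h.symm
  have haa := fun z (h : C.G.Adj z a) => (ha z).1 h.symm
  refine prism_end C m hcard hm hP hWP hWF hnd ha hu hv (key _ _ _ _ ?_) (key _ _ _ _ ?_)
    (key _ _ _ _ ?_) hmu
  · intro z hz
    have := hua w
    have := hva w
    have := hz.ne
    rcases hcov z with rfl | rfl | rfl | rfl | rfl | rfl <;> grind
  · intro z hz
    have := haa b
    have := hva b
    have := hz.ne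
    rcases hcov z with rfl | rfl | rfl | rfl | rfl | rfl <;> grind
  · intro z hz
    have := haa c
    have := hua c
    have := hz.ne
    rcases hcov z with rfl | rfl | rfl | rfl | rfl | rfl <;> grind

theorem find_tri {V : Type*} [Finite V] {G : SimpleGraph V} (hcard : Nat.card V = 6)
    (h3 : ∀ P Q, Sp G P Q → 3 ≤ ((P ∪ Q)ᶜ).ncard) {u v : V}
    {A B : Set V} (hAB : Sp G A B) (huA : u ∉ A ∪ B) (hvA : v ∉ A ∪ B)
    (hc : ((A ∪ B)ᶜ).ncard ≤ 3) : ∃ a, G.Adj a u ∧ G.Adj a v := by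
  have hc3 : ((A ∪ B)ᶜ).ncard = 3 := le_antisymm hc (h3 A B hAB)
  have hsum : A.ncard + B.ncard = 3 := by
    rw [← Set.ncard_union_eq hAB.2.2.1 (Set.toFinite _) (Set.toFinite _)]
    have := Set.ncard_add_ncard_compl (A ∪ B)
    omega
  wlog hA : A.ncard = 1 generalizing A B
  · have hA0 := (Set.ncard_pos (Set.toFinite _)).2 hAB.1
    have hB0 := (Set.ncard_pos (Set.toFinite _)).2 hAB.2.1
    rw [Set.union_comm] at huA hvA hc hc3
    exact this hAB.symm huA hvA hc hc3 (by omega) (by omega)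
  obtain ⟨a, rfl⟩ := Set.ncard_eq_one.1 hA
  have hna : ∀ z, G.Adj a z → z ∈ ({a} ∪ B)ᶜ := by
    rintro z hz (h | h)
    · exact hz.ne h.symm
    · exact hAB.2.2.2 a rfl z h hz
  have key : ∀ t ∈ ({a} ∪ B)ᶜ, G.Adj a t := by
    intro t ht
    by_contra hn
    have h2 : (({a} ∪ B)ᶜ \ {t}).ncard = 2 := by
      rw [Set.ncard_sdiff_singleton_of_mem ht, hc3]
    obtain ⟨p, q, -, hpq⟩ := Set.ncard_eq_two.1 h2
    obtain ⟨z, hz, hzp, hzq⟩ := deg3 h3 (by omega) a p q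
    have : z ∈ ({a} ∪ B)ᶜ \ {t} := ⟨hna z hz, by rintro rfl; exact hn hz⟩
    rw [hpq] at this
    rcases this with h | h
    · exact hzp h
    · exact hzq h
  exact ⟨a, key u huA, key v hvA⟩

theorem main (C : CGraph) (hWF : C.WF) (hk : KConnected 3 C.G)
    (hcomp : 3 ≤ edgeComponents C.X)
    (hP : ¬ CGIso C weirdPrism) (hWP : ¬ CGIso C wagnerPrism) : Goal C := by
  classical
  by_contra hG
  obtain ⟨-, h3⟩ := (kconn_iff C.G).1 hk
  have hcol := col_of_comp hcomp
  obtain ⟨c, hmono, hc⟩ := id hcol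
  choose a b hab hX hca using hc
  have hcb : ∀ i, c (b i) = i := fun i => by rw [← hmono _ _ (hX i), hca]
  have hinj : Function.Injective (Sum.elim a b) := by
    rintro (i | i) (j | j) h
    · have : c (a i) = c (a j) := congrArg c h
      rw [hca, hca] at this
      rw [this]
    · have h' : a i = b j := h
      have : c (a i) = c (b j) := congrArg c h
      rw [hca, hcb] at this
      subst this
      exact absurd h' (hab i)
    · have h' : b i = a j := h
      have : c (b i) = c (a j) := congrArg c h
      rw [hca, hcb] at this
      subst this
      exact absurd h'.symm (hab i)
    · have : c (b i) = c (b j) := congrArg c h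
      rw [hcb, hcb] at this
      rw [this]
  have hcard : 6 ≤ Nat.card C.V := by
    have := Nat.card_le_card_of_injective _ hinj
    simpa using this
  have hfact := fun {u v} => main_fact C hWF h3 hcard hG hcol (u := u) (v := v)
  -- some edge lies outside the constraint
  have hexne : ∃ u v, C.G.Adj u v ∧ s(u, v) ∉ C.X := by
    by_contra hcon
    push Not at hcon
    have := h3 {z | c z = 0} {z | c z ≠ 0} ⟨⟨a 0, hca 0⟩,
      ⟨a 1, by simp [hca]⟩, by rw [Set.disjoint_left]; grind, by
        intro p hp q hq hadj
        have := hmono p q (hcon p q hadj)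
        simp only [Set.mem_ofPred_eq] at hp hq
        grind⟩
    have he : ({z | c z = 0} ∪ {z | c z ≠ 0})ᶜ = (∅ : Set C.V) := by
      ext z
      simp only [Set.mem_compl_iff, Set.mem_union, Set.mem_ofPred_eq, Set.mem_empty_iff_false]
      tauto
    rw [he, Set.ncard_empty] at this
    omega
  -- every vertex is incident with such an edge
  have hall : ∀ u, ∃ v, C.G.Adj u v ∧ s(u, v) ∉ C.X := by
    by_contra hcon
    push Not at hcon
    obtain ⟨t, ht⟩ := hcon
    obtain ⟨u0, hu0⟩ := hexne
    let M : Set C.V := {u | ∃ v, C.G.Adj u v ∧ s(u, v) ∉ C.X}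
    have := h3 M Mᶜ ⟨⟨u0, hu0⟩, ⟨t, fun ⟨v, hv1, hv2⟩ => hv2 (ht v hv1)⟩, disjoint_compl_right, by
      rintro u ⟨v, huv, huvX⟩ q hq hadj
      apply hq
      obtain ⟨-, w, hw, hw1, hw2⟩ := hfact huv huvX
      by_cases hx : s(u, q) ∈ C.X
      · obtain rfl := hw1 q hx
        obtain ⟨z, hz, hzu, -⟩ := deg3 h3 hcard q u u
        exact ⟨z, hz, fun h => hzu (hw2 z h)⟩
      · exact ⟨u, hadj.symm, by rwa [Sym2.eq_swap]⟩⟩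
    rw [Set.union_compl_self, Set.compl_univ, Set.ncard_empty] at this
    omega
  -- the constraint is a perfect matching
  have hmat : ∀ u, ∃ w, ∀ z, s(u, z) ∈ C.X ↔ z = w := by
    intro u
    obtain ⟨v, h1, h2⟩ := hall u
    obtain ⟨-, w, hw, hw1, -⟩ := hfact h1 h2
    exact ⟨w, fun z => ⟨hw1 z, by rintro rfl; exact hw⟩⟩
  choose m hm using hmat
  have hdeg : ∀ x, ∃ p q r, ∀ z, C.G.Adj x z → z = p ∨ z = q ∨ z = r := by
    intro x
    obtain ⟨v, h1, h2⟩ := hall x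
    obtain ⟨⟨p, q, hpq⟩, -⟩ := hfact h1 h2
    refine ⟨v, p, q, fun z hz => ?_⟩
    by_cases hzv : z = v
    · exact Or.inl hzv
    · refine Or.inr (hpq z ((del_adj _ _ _ _ _).2 ⟨hz, ?_⟩))
      have := h1.ne
      grind
  have hmm : ∀ x, m (m x) = x := fun x => by
    have := (hm x (m x)).2 rfl
    rw [Sym2.eq_swap, hm] at this
    exact this.symm
  have hma : ∀ i, m (a i) = b i := fun i => ((hm _ _).1 (hX i)).symm
  have hmb : ∀ i, m (b i) = a i := fun i => by rw [← hma, hmm]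
  have hsurj : Function.Surjective (Sum.elim a b) := by
    by_contra hns
    unfold Function.Surjective at hns
    push Not at hns
    obtain ⟨t, ht⟩ := hns
    have hta : ∀ i, a i ≠ t := fun i => ht (Sum.inl i)
    have htb : ∀ i, b i ≠ t := fun i => ht (Sum.inr i)
    have hcol4 : Col 4 C.X := by
      have hin : ∀ z, (∃ i, z = a i ∨ z = b i) ↔ ∃ i, m z = a i ∨ m z = b i := by
        intro z
        constructor
        · rintro ⟨i, rfl | rfl⟩
          · exact ⟨i, Or.inr (hma i)⟩
          · exact ⟨i, Or.inl (hmb i)⟩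
        · rintro ⟨i, h | h⟩
          · exact ⟨i, Or.inr (by rw [← hmm z, h, hma])⟩
          · exact ⟨i, Or.inl (by rw [← hmm z, h, hmb])⟩
      have htn : ¬ ∃ i, t = a i ∨ t = b i := by
        rintro ⟨i, h | h⟩
        · exact hta i h.symm
        · exact htb i h.symm
      refine ⟨fun z => if ∃ i, z = a i ∨ z = b i then (c z).castSucc else Fin.last 3, ?_, ?_⟩
      · intro p q hpq
        have hc' := hmono p q hpq
        rw [hm] at hpq
        subst hpq
        have := hin p
        beta_reduce
        by_cases h : ∃ i, p = a i ∨ p = b i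
        · rw [if_pos h, if_pos (this.1 h), hc']
        · rw [if_neg h, if_neg (fun h' => h (this.2 h'))]
      · intro i
        refine Fin.lastCases ?_ (fun i => ?_) i
        · refine ⟨t, m t, ?_, (hm _ _).2 rfl, if_neg htn⟩
          exact (show C.G.Adj t (m t) from hWF ((hm _ _).2 rfl)).ne
        · refine ⟨a i, b i, hab i, hX i, ?_⟩
          have : ∃ j, a i = a j ∨ a i = b j := ⟨i, Or.inl rfl⟩
          beta_reduce
          rw [if_pos this, hca]
    obtain ⟨u, v, huv, huvX⟩ := hexne
    obtain ⟨x, hux, hxv, -⟩ := deg3 h3 hcard u v v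
    exact (main_step C h3 hcard hG hcol huv huvX).2 x hux hxv hux.ne'
      (col_drop (n := 2) hcol4 hux.ne')
  have hcard6 : Nat.card C.V = 6 := by
    rw [← Nat.card_eq_of_bijective _ ⟨hinj, hsurj⟩]
    simp
  obtain ⟨u, v, huv, huvX⟩ := hexne
  obtain ⟨A, B, hAB, huA, hvA, hc⟩ := contract_bad (by omega) h3 huv.ne
    (not_contr C hG hcol huv huvX)
  obtain ⟨t, htu, htv⟩ := find_tri hcard6 h3 hAB huA hvA hc
  exact tri_end C m hcard6 h3 hm hP hWP hWF hdeg htu htv huv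
    (fun h => huvX ((hm u v).2 h.symm))

end endgame

end COr

/-- **Lemma (contract_or).** If `G[X]` has at least three components and `(G, X)` is none of
the constraint Wagner graph, the weird prism and the Wagner prism, then `(G, X)` has a
3-connected constraint minor `(G', X')` with `X'` disconnected and strictly fewer edges
outside the constraint. -/
theorem contract_or (C : CGraph) (hWF : C.WF) (h3 : KConnected 3 C.G)
    (hcomp : 3 ≤ edgeComponents C.X)
    (hW : ¬ CGIso C constraintWagner) (hP : ¬ CGIso C weirdPrism)
    (hWP : ¬ CGIso C wagnerPrism) :
    ∃ C', IsCMinor C C' ∧ KConnected 3 C'.G ∧ ¬ EdgeSetConnected C'.X ∧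
      (C'.G.edgeSet \ C'.X).ncard < (C.G.edgeSet \ C.X).ncard := by
  exact COr.main C hWF h3 hcomp hP hWP
end
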